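/- arXiv:2101.01146 — 2 statements merged into one kernel-verified Lean document; each statement's English description precedes it below -/
import Mathlib

section
/- There is a universal constant C > 0 such that for every weighted graph G = (V, E, w) on n ≥ 2 vertices and every ε ∈ (0,1] there exist m ∈ ℕ, nonnegative reals p_1,…,p_m summing to 1, and spanning clan embeddings (f_1,χ_1),…,(f_m,χ_m) of G into trees, each with multiplicative distortion at most C·(log₂ n)·(1 + log₂ log₂ n)/ε, such that for every vertex v ∈ V one has Σ_{i=1}^m p_i·|f_i(v)| ≤ 1 + ε. -/
/-- The shortest-path metric of a weighted graph: the infimum of the total edge weight of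
walks from `u` to `v`. -/
noncomputable def spDist {V : Type*} (G : SimpleGraph V) (w : Sym2 V → ℝ) (u v : V) : ℝ :=
  sInf (Set.range fun p : G.Walk u v => (p.edges.map w).sum)

/-- `(f, χ)` is a spanning clan embedding of the weighted graph `(G, wG)` into the
weighted tree `(T, wT)` with multiplicative distortion `t`. -/
def IsSpanningClanTree {V Y : Type*}
    (G : SimpleGraph V) (wG : Sym2 V → ℝ)
    (T : SimpleGraph Y) (wT : Sym2 Y → ℝ)
    (f : V → Finset Y) (χ : V → Y) (t : ℝ) : Prop :=
  T.IsTree ∧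
  (∀ e ∈ T.edgeSet, 0 < wT e) ∧
  (∀ v, (f v).Nonempty) ∧
  (∀ u v : V, u ≠ v → Disjoint (f u) (f v)) ∧
  (∀ y : Y, ∃ v : V, y ∈ f v) ∧
  (∀ (u v : V) (u' v' : Y), u' ∈ f u → v' ∈ f v → T.Adj u' v' →
      G.Adj u v ∧ wT s(u', v') = wG s(u, v)) ∧
  (∀ u v : V, u ≠ v → ∀ u' ∈ f u, ∀ v' ∈ f v, spDist G wG u v ≤ spDist T wT u' v') ∧
  (∀ v, χ v ∈ f v) ∧
  (∀ u v : V, ∃ v' ∈ f v, spDist T wT v' (χ u) ≤ t * spDist G wG u v)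

/-! ### Part A: basic facts on `spDist` -/

lemma walk_len_nonneg {V : Type*} {G : SimpleGraph V} {w : Sym2 V → ℝ}
    (hw : ∀ e ∈ G.edgeSet, 0 < w e) {u v : V} (p : G.Walk u v) : 0 ≤ (p.edges.map w).sum := by
  apply List.sum_nonneg
  intro x hx
  obtain ⟨e, he, rfl⟩ := List.mem_map.1 hx
  exact (hw e (p.edges_subset_edgeSet he)).le

lemma spDist_le_walk {V : Type*} {G : SimpleGraph V} {w : Sym2 V → ℝ}
    (hw : ∀ e ∈ G.edgeSet, 0 < w e) {u v : V} (p : G.Walk u v) :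
    spDist G w u v ≤ (p.edges.map w).sum :=
  csInf_le ⟨0, by rintro _ ⟨q, rfl⟩; exact walk_len_nonneg hw q⟩ ⟨p, rfl⟩

lemma le_spDist {V : Type*} {G : SimpleGraph V} {w : Sym2 V → ℝ}
    (hG : G.Connected) {u v : V} {L : ℝ}
    (h : ∀ p : G.Walk u v, L ≤ (p.edges.map w).sum) : L ≤ spDist G w u v := by
  obtain ⟨p⟩ := hG.preconnected u v
  exact le_csInf ⟨_, p, rfl⟩ (by rintro _ ⟨q, rfl⟩; exact h q)

lemma spDist_nonneg {V : Type*} {G : SimpleGraph V} {w : Sym2 V → ℝ}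
    (hw : ∀ e ∈ G.edgeSet, 0 < w e) (u v : V) : 0 ≤ spDist G w u v :=
  Real.sInf_nonneg (by rintro _ ⟨q, rfl⟩; exact walk_len_nonneg hw q)

lemma spDist_self {V : Type*} {G : SimpleGraph V} {w : Sym2 V → ℝ}
    (hw : ∀ e ∈ G.edgeSet, 0 < w e) (u : V) : spDist G w u u = 0 :=
  le_antisymm (by simpa using spDist_le_walk hw (SimpleGraph.Walk.nil : G.Walk u u))
    (spDist_nonneg hw u u)

lemma spDist_symm {V : Type*} {G : SimpleGraph V} {w : Sym2 V → ℝ}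
    (hG : G.Connected) (hw : ∀ e ∈ G.edgeSet, 0 < w e) (u v : V) :
    spDist G w u v = spDist G w v u := by
  have key : ∀ u v, spDist G w u v ≤ spDist G w v u := by
    intro u v
    apply le_spDist hG
    intro p
    have := spDist_le_walk hw p.reverse
    simpa [List.sum_reverse] using this
  exact le_antisymm (key u v) (key v u)

lemma spDist_edge {V : Type*} {G : SimpleGraph V} {w : Sym2 V → ℝ}
    (hw : ∀ e ∈ G.edgeSet, 0 < w e) {u v : V} (h : G.Adj u v) : spDist G w u v ≤ w s(u, v) := by
  simpa using spDist_le_walk hw (SimpleGraph.Walk.cons h SimpleGraph.Walk.nil)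

lemma spDist_tri {V : Type*} {G : SimpleGraph V} {w : Sym2 V → ℝ}
    (hG : G.Connected) (hw : ∀ e ∈ G.edgeSet, 0 < w e) (u v x : V) :
    spDist G w u x ≤ spDist G w u v + spDist G w v x := by
  have h1 : ∀ p : G.Walk u v, spDist G w u x - (p.edges.map w).sum ≤ spDist G w v x := by
    intro p
    apply le_spDist hG
    intro q
    have := spDist_le_walk hw (p.append q)
    simp only [SimpleGraph.Walk.edges_append, List.map_append, List.sum_append] at this
    linarith
  have h2 : spDist G w u x - spDist G w v x ≤ spDist G w u v := by
    apply le_spDist hG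
    intro p
    linarith [h1 p]
  linarith

lemma spDist_pred {V : Type*} [Finite V] {G : SimpleGraph V} {w : Sym2 V → ℝ}
    (hG : G.Connected) (hw : ∀ e ∈ G.edgeSet, 0 < w e) {u v : V} (huv : u ≠ v) :
    ∃ z, G.Adj z v ∧ spDist G w u z + w s(z, v) = spDist G w u v := by
  have hne : (G.neighborSet v).Nonempty := by
    obtain ⟨p⟩ := hG.preconnected v u
    cases p with
    | nil => exact absurd rfl huv
    | cons h q => exact ⟨_, h⟩
  obtain ⟨z, hz, hmin⟩ := Set.exists_min_image (G.neighborSet v)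
    (fun z => spDist G w u z + w s(z, v)) (Set.toFinite _) hne
  have hz' : G.Adj z v := (show G.Adj v z from hz).symm
  refine ⟨z, hz', le_antisymm ?_ ?_⟩
  · apply le_spDist hG
    intro p
    have key : ∀ q : G.Walk v u, spDist G w u z + w s(z, v) ≤ (q.edges.map w).sum := by
      intro q
      cases q with
      | nil => exact absurd rfl huv
      | @cons _ y _ h q =>
        have h1 := hmin y h
        have h2 := spDist_le_walk hw q
        rw [spDist_symm hG hw] at h2
        simp only [SimpleGraph.Walk.edges_cons, List.map_cons, List.sum_cons]
        have h3 : s(v, y) = s(y, v) := Sym2.eq_swap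
        rw [h3]
        linarith
    have := key p.reverse
    simpa [List.sum_reverse] using this
  · exact (spDist_tri hG hw u z v).trans (by linarith [spDist_edge hw hz'])

lemma spDist_map_le {Y V : Type*} {T : SimpleGraph Y} {G : SimpleGraph V} {w : Sym2 V → ℝ}
    {wT : Sym2 Y → ℝ}
    (hT : T.Connected) (hw : ∀ e ∈ G.edgeSet, 0 < w e) (π : T →g G)
    (hwT : ∀ e, wT e = w (e.map π)) (a b : Y) :
    spDist G w (π a) (π b) ≤ spDist T wT a b := by
  apply le_spDist hT
  intro p
  have := spDist_le_walk hw (p.map π)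
  rw [SimpleGraph.Walk.edges_map, List.map_map] at this
  convert this using 3
  funext e
  exact hwT e

/-! ### Part B: joining two trees with an edge -/

lemma isTree_join {Y0 Y1 : Type*} [Finite Y0] [Finite Y1] {T0 : SimpleGraph Y0}
    {T1 : SimpleGraph Y1} (h0 : T0.IsTree) (h1 : T1.IsTree) (a : Y0) (b : Y1) :
    (T0.sum T1 ⊔ SimpleGraph.edge (Sum.inl a) (Sum.inr b)).IsTree := by
  have hc : (T0.sum T1 ⊔ SimpleGraph.edge (Sum.inl a) (Sum.inr b)).Connected :=
    SimpleGraph.Connected.sum_sup_edge h0.connected h1.connected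
  rw [SimpleGraph.isTree_iff_connected_and_card]
  refine ⟨hc, le_antisymm ?_ hc.card_vert_le_card_edgeSet_add_one⟩
  have e0 := (SimpleGraph.isTree_iff_connected_and_card.1 h0).2
  have e1 := (SimpleGraph.isTree_iff_connected_and_card.1 h1).2
  have hs : Nat.card (T0.sum T1).edgeSet = Nat.card T0.edgeSet + Nat.card T1.edgeSet := by
    rw [Nat.card_congr SimpleGraph.edgeSetSumEquiv, Nat.card_sum]
  have hle : Nat.card (T0.sum T1 ⊔ SimpleGraph.edge (Sum.inl a) (Sum.inr b)).edgeSet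
      ≤ Nat.card (T0.sum T1).edgeSet + 1 := by
    rw [SimpleGraph.edgeSet_sup]
    have : (SimpleGraph.edge (Sum.inl a : Y0 ⊕ Y1) (Sum.inr b)).edgeSet ⊆
      {s(Sum.inl a, Sum.inr b)} := by
      rw [SimpleGraph.edge]
      exact (SimpleGraph.edgeSet_fromEdgeSet _).le.trans (fun _ h => h.1)
    rw [Nat.card_coe_set_eq, Nat.card_coe_set_eq]
    refine (Set.ncard_union_le _ _).trans ?_
    gcongr
    exact (Set.ncard_le_ncard this).trans (Set.ncard_singleton _).le
  rw [Nat.card_sum]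
  omega

/-! ### Part C: geodesic metrics on subsets -/

/-- `d` is the shortest path metric of the weighted graph induced on `S`. -/
structure Geo {V : Type*} (G : SimpleGraph V) (S : Set V) (u : Sym2 V → ℝ)
    (d : V → V → ℝ) : Prop where
  self : ∀ a ∈ S, d a a = 0
  symm : ∀ a ∈ S, ∀ b ∈ S, d a b = d b a
  tri : ∀ a ∈ S, ∀ b ∈ S, ∀ c ∈ S, d a c ≤ d a b + d b c
  edge : ∀ a ∈ S, ∀ b ∈ S, G.Adj a b → d a b ≤ u s(a, b)
  pred : ∀ a ∈ S, ∀ b ∈ S, a ≠ b → ∃ z ∈ S, G.Adj z b ∧ d a z + u s(z, b) = d a b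

lemma Geo.nonneg {V : Type*} {G : SimpleGraph V} {S : Set V} {u : Sym2 V → ℝ}
    {d : V → V → ℝ} (h : Geo G S u d) {a b : V} (ha : a ∈ S) (hb : b ∈ S) : 0 ≤ d a b := by
  have h1 := h.tri a ha b hb a ha
  rw [h.self a ha, h.symm b hb a ha] at h1
  linarith

lemma Geo.pos {V : Type*} {G : SimpleGraph V} {S : Set V} {u : Sym2 V → ℝ}
    {d : V → V → ℝ} (h : Geo G S u d) (hu : ∀ a b, G.Adj a b → 0 < u s(a, b))
    {a b : V} (ha : a ∈ S) (hb : b ∈ S) (hab : a ≠ b) : 0 < d a b := by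
  obtain ⟨z, hz, hzb, he⟩ := h.pred a ha b hb hab
  have := h.nonneg ha hz
  have := hu _ _ hzb
  linarith

lemma geo_exists {V : Type*} [Finite V] {G : SimpleGraph V} {S : Set V} {u : Sym2 V → ℝ}
    (hu : ∀ a b, G.Adj a b → 0 < u s(a, b)) (hS : (G.induce S).Connected) :
    ∃ d, Geo G S u d := by
  classical
  have hw : ∀ e ∈ (G.induce S).edgeSet, 0 < (fun e : Sym2 S => u (e.map Subtype.val)) e := by
    intro e
    induction e with
    | _ a b =>
      intro h
      exact hu _ _ h
  refine ⟨fun a b => if h : a ∈ S ∧ b ∈ S then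
    spDist (G.induce S) (fun e : Sym2 S => u (e.map Subtype.val)) ⟨a, h.1⟩ ⟨b, h.2⟩ else 0,
    ⟨?_, ?_, ?_, ?_, ?_⟩⟩
  · intro a ha
    simp [ha, spDist_self hw]
  · intro a ha b hb
    simp only [ha, hb, and_self, dite_true]
    exact spDist_symm hS hw _ _
  · intro a ha b hb c hc
    simp only [ha, hb, hc, and_self, dite_true]
    exact spDist_tri hS hw _ _ _
  · intro a ha b hb hab
    simp only [ha, hb, and_self, dite_true]
    exact spDist_edge hw (u := ⟨a, ha⟩) (v := ⟨b, hb⟩) hab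
  · intro a ha b hb hab
    obtain ⟨z, hz, he⟩ := spDist_pred hS hw (u := ⟨a, ha⟩) (v := ⟨b, hb⟩)
      (fun h => hab (congrArg Subtype.val h))
    refine ⟨z.1, z.2, hz, ?_⟩
    simp only [ha, hb, z.2, and_self, dite_true]
    exact he

/-- Induction along geodesics. -/
lemma Geo.ind {V : Type*} [Finite V] {G : SimpleGraph V} {S : Set V} {u : Sym2 V → ℝ}
    {d : V → V → ℝ} (h : Geo G S u d) (hu : ∀ a b, G.Adj a b → 0 < u s(a, b))
    {a : V} (ha : a ∈ S) (P : V → Prop) (h0 : P a)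
    (h1 : ∀ z ∈ S, ∀ b ∈ S, G.Adj z b → d a z + u s(z, b) = d a b → P z → P b) :
    ∀ b ∈ S, P b := by
  have wf : WellFounded (fun x y : V => d a x < d a y) := by
    have : IsTrans V (fun x y : V => d a x < d a y) := ⟨fun _ _ _ h1 h2 => lt_trans h1 h2⟩
    have : Std.Irrefl (fun x y : V => d a x < d a y) := ⟨fun _ h1 => lt_irrefl _ h1⟩
    exact Finite.wellFounded_of_trans_of_irrefl _
  intro b
  induction b using wf.induction with
  | _ b ih =>
    intro hb
    by_cases hab : a = b
    · exact hab ▸ h0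
    obtain ⟨z, hz, hzb, he⟩ := h.pred a ha b hb hab
    exact h1 z hz b hb hzb he (ih z (by have := hu _ _ hzb; linarith) hz)

/-- Upper bound for the metric of a piece, by following geodesics inside `K`. -/
lemma Geo.transfer {V : Type*} [Finite V] {G : SimpleGraph V} {S Z K : Set V}
    {u u' : Sym2 V → ℝ} {d d' : V → V → ℝ} (h : Geo G S u d) (h' : Geo G Z u' d')
    (hu : ∀ a b, G.Adj a b → 0 < u s(a, b))
    (huu : ∀ a ∈ Z, ∀ b ∈ Z, G.Adj a b → u' s(a, b) ≤ u s(a, b))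
    (hKZ : K ⊆ Z) {a : V} (ha : a ∈ S) (haZ : a ∈ Z)
    (hK : ∀ z ∈ S, ∀ b ∈ S, b ∈ K → G.Adj z b → d a z + u s(z, b) = d a b → z ∈ K) :
    ∀ b ∈ S, b ∈ K → d' a b ≤ d a b := by
  apply h.ind hu ha
  · intro _
    rw [h.self a ha, h'.self a haZ]
  · intro z hz b hb hzb he ih hbK
    have hzK := hK z hz b hb hbK hzb he
    have h1 := h'.tri a haZ z (hKZ hzK) b (hKZ hbK)
    have h2 := h'.edge z (hKZ hzK) b (hKZ hbK) hzb
    have h3 := huu z (hKZ hzK) b (hKZ hbK) hzb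
    linarith [ih hzK]

/-- Reachability inside a set. -/
def ReachIn {V : Type*} (G : SimpleGraph V) (Z : Set V) (a b : V) : Prop :=
  Relation.ReflTransGen (fun x y => G.Adj x y ∧ x ∈ Z ∧ y ∈ Z) a b

lemma connected_of_reachIn {V : Type*} {G : SimpleGraph V} {Z : Set V} {a : V} (ha : a ∈ Z)
    (h : ∀ b ∈ Z, ReachIn G Z a b) : (G.induce Z).Connected := by
  have key : ∀ b, ReachIn G Z a b → ∃ hb : b ∈ Z, (G.induce Z).Reachable ⟨a, ha⟩ ⟨b, hb⟩ := by
    intro b hb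
    induction hb with
    | refl => exact ⟨ha, SimpleGraph.Reachable.refl _⟩
    | @tail y z _ hyz ih =>
      obtain ⟨hy, hr⟩ := ih
      refine ⟨hyz.2.2, hr.trans (SimpleGraph.Adj.reachable ?_)⟩
      exact hyz.1
  rw [SimpleGraph.connected_iff_exists_forall_reachable]
  refine ⟨⟨a, ha⟩, fun b => ?_⟩
  obtain ⟨_, hr⟩ := key b.1 (h b.1 b.2)
  exact hr

lemma Geo.reach {V : Type*} [Finite V] {G : SimpleGraph V} {S Z K : Set V}
    {u : Sym2 V → ℝ} {d : V → V → ℝ} (h : Geo G S u d)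
    (hu : ∀ a b, G.Adj a b → 0 < u s(a, b))
    (hKZ : K ⊆ Z) {a : V} (ha : a ∈ S)
    (hK : ∀ z ∈ S, ∀ b ∈ S, b ∈ K → G.Adj z b → d a z + u s(z, b) = d a b → z ∈ K) :
    ∀ b ∈ S, b ∈ K → ReachIn G Z a b := by
  apply h.ind hu ha
  · intro _
    exact Relation.ReflTransGen.refl
  · intro z hz b hb hzb he ih hbK
    have hzK := hK z hz b hb hbK hzb he
    exact (ih hzK).tail ⟨hzb, hKZ hzK, hKZ hbK⟩

/-- Lower bound for the metric. -/
lemma Geo.lower {V : Type*} [Finite V] {G : SimpleGraph V} {Z : Set V}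
    {u' : Sym2 V → ℝ} {d' : V → V → ℝ} (h' : Geo G Z u' d')
    (hu : ∀ a b, G.Adj a b → 0 < u' s(a, b)) {a : V} (ha : a ∈ Z) (D : V → ℝ) (h0 : D a ≤ 0)
    (hD : ∀ z ∈ Z, ∀ b ∈ Z, G.Adj z b → D b ≤ D z + u' s(z, b)) :
    ∀ b ∈ Z, D b ≤ d' a b := by
  apply h'.ind hu ha
  · rw [h'.self a ha]; exact h0
  · intro z hz b hb hzb he ih
    linarith [hD z hz b hb hzb]


/-! ### Part D: choosing the radius -/

lemma select_radius (α L A : ℝ) (N : ℕ) (hα : 0 < α) (hL : Real.logb 2 A ≤ L) (hN1 : 1 ≤ N)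
    (hN : L ≤ (1 + α) ^ N) (a : ℕ → ℝ) (hmono : Monotone a) (h0 : 1 ≤ a 0)
    (hend : a (2 * N) ≤ A - 1) :
    ∃ i < 2 * N, a (i + 1) ^ (1 + α) + (A - a i) ^ (1 + α) ≤ A ^ (1 + α) := by
  by_contra hcon
  push Not at hcon
  have ha1 : ∀ i, 1 ≤ a i := fun i => h0.trans (hmono (Nat.zero_le i))
  have haA : ∀ i ≤ 2 * N, 1 ≤ A - a i := fun i hi => by linarith [hmono hi]
  have hA : 0 < A := by linarith [ha1 0, haA 0 (by omega)]
  have hAsplit : A ^ (1 + α) = A * A ^ α := by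
    rw [Real.rpow_add hA, Real.rpow_one]
  set b : ℕ → ℝ := fun i => Real.logb 2 A - Real.logb 2 (a i) with hb
  set c : ℕ → ℝ := fun i => Real.logb 2 A - Real.logb 2 (A - a i) with hc
  have hle : ∀ x : ℝ, 0 < x → x ≤ A → x ^ (1 + α) ≤ x * A ^ α := by
    intro x hx hxA
    rw [Real.rpow_add hx, Real.rpow_one]
    gcongr
  have hlog : ∀ x y : ℝ, 0 < x → 0 < y → y * A ^ α < x ^ (1 + α) →
      Real.logb 2 y + α * Real.logb 2 A < (1 + α) * Real.logb 2 x := by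
    intro x y hx hy h
    have h1 := Real.logb_lt_logb (b := 2) (by norm_num) (by positivity) h
    rwa [Real.logb_rpow_eq_mul_logb_of_pos hx, Real.logb_mul hy.ne' (by positivity),
      Real.logb_rpow_eq_mul_logb_of_pos hA] at h1
  have hbstep : ∀ i < 2 * N, (1 + α) * b (i + 1) < b i := by
    intro i hi
    have h1 := hcon i hi
    have p1 := ha1 i
    have p2 := ha1 (i + 1)
    have p3 := haA i (by omega)
    have h2 := hle (A - a i) (by linarith) (by linarith)
    have h3 : a i * A ^ α < a (i + 1) ^ (1 + α) := by
      rw [hAsplit] at h1; nlinarith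
    have := hlog _ _ (by linarith) (by linarith) h3
    simp only [hb]
    linarith
  have hcstep : ∀ i < 2 * N, (1 + α) * c i < c (i + 1) := by
    intro i hi
    have h1 := hcon i hi
    have p1 := ha1 i
    have p2 := ha1 (i + 1)
    have p3 := haA i (by omega)
    have p4 := haA (i + 1) (by omega)
    have h2 := hle (a (i + 1)) (by linarith) (by linarith)
    have h3 : (A - a (i + 1)) * A ^ α < (A - a i) ^ (1 + α) := by
      rw [hAsplit] at h1; nlinarith
    have := hlog _ _ (by linarith) (by linarith) h3
    simp only [hc]
    linarith
  have hlog2 : Real.logb 2 2 = 1 := Real.logb_self_eq_one (by norm_num)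
  rcases le_total (a N) (A / 2) with hcase | hcase
  · have hbN : 1 ≤ b N := by
      have h1 : Real.logb 2 (a N) ≤ Real.logb 2 (A / 2) :=
        Real.logb_le_logb_of_le (by norm_num) (by linarith [ha1 N]) hcase
      rw [Real.logb_div hA.ne' (by norm_num), hlog2] at h1
      simp only [hb]; linarith
    have hind : ∀ j ≤ N, (1 + α) ^ j * b j ≤ b 0 := by
      intro j
      induction j with
      | zero => intro _; simp
      | succ j ih =>
        intro hj
        have h1 := ih (by omega)
        have h2 := hbstep j (by omega)
        have h3 : 0 < (1 + α) ^ j := by positivity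
        rw [pow_succ]
        nlinarith
    obtain ⟨M, rfl⟩ : ∃ M, N = M + 1 := ⟨N - 1, by omega⟩
    have h1 := hind M (by omega)
    have h2 := hbstep M (by omega)
    have h3 : 0 < (1 + α) ^ M := by positivity
    have hb0 : b 0 ≤ L := by
      have : 0 ≤ Real.logb 2 (a 0) := Real.logb_nonneg (by norm_num) h0
      simp only [hb]; linarith
    rw [pow_succ] at hN
    have h4 : 0 < (1 + α) ^ M * (1 + α) := by positivity
    nlinarith
  · have hcN : 1 ≤ c N := by
      have h1 : Real.logb 2 (A - a N) ≤ Real.logb 2 (A / 2) :=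
        Real.logb_le_logb_of_le (by norm_num) (by linarith [haA N (by omega)]) (by linarith)
      rw [Real.logb_div hA.ne' (by norm_num), hlog2] at h1
      simp only [hc]; linarith
    have hind : ∀ j ≤ N, (1 + α) ^ j * c N ≤ c (N + j) := by
      intro j
      induction j with
      | zero => intro _; simp
      | succ j ih =>
        intro hj
        have h1 := ih (by omega)
        have h2 := hcstep (N + j) (by omega)
        rw [pow_succ, ← add_assoc]
        nlinarith
    obtain ⟨M, rfl⟩ : ∃ M, N = M + 1 := ⟨N - 1, by omega⟩
    have h1 := hind M (by omega)
    have h2 := hcstep (M + 1 + M) (by omega)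
    have h3 : 0 < (1 + α) ^ M := by positivity
    have hb0 : c (M + 1 + M + 1) ≤ L := by
      have : 0 ≤ Real.logb 2 (A - a (M + 1 + M + 1)) :=
        Real.logb_nonneg (by norm_num) (haA _ (by omega))
      simp only [hc]; linarith
    rw [pow_succ] at hN
    have h4 : 0 < (1 + α) ^ M * (1 + α) := by positivity
    have h5 : (1 + α) ^ M * (1 + α) ≤ (1 + α) ^ M * (1 + α) * c (M + 1) := by nlinarith
    nlinarith

/-! ### Part E: highways and petals -/

open Classical in
/-- Edge weights, halved on the highway `H`. -/
noncomputable def hwt {V : Type*} (w : Sym2 V → ℝ) (H : Set V) : Sym2 V → ℝ :=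
  fun e => if ∀ a ∈ e, a ∈ H then w e / 2 else w e

lemma hwt_of_mem {V : Type*} (w : Sym2 V → ℝ) {H : Set V} {a b : V} (ha : a ∈ H) (hb : b ∈ H) :
    hwt w H s(a, b) = w s(a, b) / 2 := by
  unfold hwt
  rw [if_pos]
  intro c hc
  rcases Sym2.mem_iff.1 hc with rfl | rfl <;> assumption

lemma hwt_of_not {V : Type*} (w : Sym2 V → ℝ) {H : Set V} {a b : V} (h : ¬ (a ∈ H ∧ b ∈ H)) :
    hwt w H s(a, b) = w s(a, b) := by
  unfold hwt
  rw [if_neg]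
  intro hc
  exact h ⟨hc a (Sym2.mem_mk_left a b), hc b (Sym2.mem_mk_right a b)⟩

lemma hwt_congr {V : Type*} (w : Sym2 V → ℝ) {H H' : Set V} {a b : V}
    (ha : a ∈ H ↔ a ∈ H') (hb : b ∈ H ↔ b ∈ H') :
    hwt w H s(a, b) = hwt w H' s(a, b) := by
  by_cases h : a ∈ H ∧ b ∈ H
  · rw [hwt_of_mem w h.1 h.2, hwt_of_mem w (ha.1 h.1) (hb.1 h.2)]
  · rw [hwt_of_not w h, hwt_of_not w (fun h' => h ⟨ha.2 h'.1, hb.2 h'.2⟩)]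

lemma hwt_bounds {V : Type*} (w : Sym2 V → ℝ) (H : Set V) {a b : V} (hw : 0 < w s(a, b)) :
    0 < hwt w H s(a, b) ∧ hwt w H s(a, b) ≤ w s(a, b) ∧ w s(a, b) ≤ 2 * hwt w H s(a, b) := by
  by_cases h : a ∈ H ∧ b ∈ H
  · rw [hwt_of_mem w h.1 h.2]
    refine ⟨?_, ?_, ?_⟩ <;> linarith
  · rw [hwt_of_not w h]
    refine ⟨?_, ?_, ?_⟩ <;> linarith

/-- `Q` is a geodesic starting at the center (positions measured by `pos`). -/
structure HW {V : Type*} (G : SimpleGraph V) (u : Sym2 V → ℝ) (pos : V → ℝ) (Q : Set V) :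
    Prop where
  inj : ∀ a ∈ Q, ∀ b ∈ Q, pos a = pos b → a = b
  step : ∀ a ∈ Q, ∀ b ∈ Q, pos a < pos b →
    ∃ z ∈ Q, G.Adj z b ∧ pos a ≤ pos z ∧ pos z + u s(z, b) = pos b

lemma HW.chain {V : Type*} [Finite V] {G : SimpleGraph V} {u u' : Sym2 V → ℝ} {pos : V → ℝ}
    {Q Z : Set V} {d' : V → V → ℝ} {κ : ℝ} (h : HW G u pos Q) (h' : Geo G Z u' d')
    (hu : ∀ a b, G.Adj a b → 0 < u s(a, b))
    (hup : ∀ a ∈ Q, a ∈ Z → ∀ z ∈ Q, pos a ≤ pos z → z ∈ Z)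
    (hk : ∀ a ∈ Q, a ∈ Z → ∀ b ∈ Q, b ∈ Z → G.Adj a b → u' s(a, b) ≤ κ * u s(a, b))
    {a : V} (ha : a ∈ Q) (haZ : a ∈ Z) :
    ∀ b ∈ Q, pos a ≤ pos b → d' a b ≤ κ * (pos b - pos a) := by
  have wf : WellFounded (fun x y : V => pos x < pos y) := by
    have : IsTrans V (fun x y : V => pos x < pos y) := ⟨fun _ _ _ h1 h2 => lt_trans h1 h2⟩
    have : Std.Irrefl (fun x y : V => pos x < pos y) := ⟨fun _ h1 => lt_irrefl _ h1⟩
    exact Finite.wellFounded_of_trans_of_irrefl _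
  intro b
  induction b using wf.induction with
  | _ b ih =>
    intro hb hab
    rcases hab.eq_or_lt with he | hlt
    · have := h.inj a ha b hb he
      subst this
      rw [h'.self a haZ]; simp
    obtain ⟨z, hz, hzb, haz, he⟩ := h.step a ha b hb hlt
    have hp := hu _ _ hzb
    have hzZ := hup a ha haZ z hz haz
    have hbZ := hup a ha haZ b hb hab
    have h1 := ih z (by linarith) hz haz
    have h2 := h'.tri a haZ z hzZ b hbZ
    have h3 := h'.edge z hzZ b hbZ hzb
    have h4 := hk z hz hzZ b hb hbZ hzb
    rw [← he]
    linarith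

lemma HW.reach {V : Type*} [Finite V] {G : SimpleGraph V} {u : Sym2 V → ℝ} {pos : V → ℝ}
    {Q Z : Set V} (h : HW G u pos Q)
    (hu : ∀ a b, G.Adj a b → 0 < u s(a, b))
    (hup : ∀ a ∈ Q, a ∈ Z → ∀ z ∈ Q, pos a ≤ pos z → z ∈ Z)
    {a : V} (ha : a ∈ Q) (haZ : a ∈ Z) :
    ∀ b ∈ Q, pos a ≤ pos b → ReachIn G Z a b := by
  have wf : WellFounded (fun x y : V => pos x < pos y) := by
    have : IsTrans V (fun x y : V => pos x < pos y) := ⟨fun _ _ _ h1 h2 => lt_trans h1 h2⟩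
    have : Std.Irrefl (fun x y : V => pos x < pos y) := ⟨fun _ h1 => lt_irrefl _ h1⟩
    exact Finite.wellFounded_of_trans_of_irrefl _
  intro b
  induction b using wf.induction with
  | _ b ih =>
    intro hb hab
    rcases hab.eq_or_lt with he | hlt
    · have := h.inj a ha b hb he
      subst this
      exact Relation.ReflTransGen.refl
    obtain ⟨z, hz, hzb, haz, he⟩ := h.step a ha b hb hlt
    have hp := hu _ _ hzb
    exact (ih z (by linarith) hz haz).tail
      ⟨hzb, hup a ha haZ z hz haz, hup a ha haZ b hb hab⟩

lemma HW.exists_path {V : Type*} [Finite V] {G : SimpleGraph V} {S : Set V} {u : Sym2 V → ℝ}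
    {d : V → V → ℝ} (h : Geo G S u d) (hu : ∀ a b, G.Adj a b → 0 < u s(a, b))
    {x0 : V} (hx : x0 ∈ S) :
    ∀ b ∈ S, ∃ Q ⊆ S, x0 ∈ Q ∧ b ∈ Q ∧ HW G u (d x0) Q ∧ ∀ q ∈ Q, d x0 q ≤ d x0 b := by
  apply h.ind hu hx
  · refine ⟨{x0}, by simpa using hx, rfl, rfl, ⟨?_, ?_⟩, ?_⟩
    · rintro a rfl b rfl _; rfl
    · rintro a rfl b rfl hlt
      exact absurd hlt (lt_irrefl _)
    · rintro q rfl; exact le_rfl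
  · rintro z hz b hb hzb he ⟨Q, hQS, hx0Q, hzQ, hQ, hmax⟩
    have hp := hu _ _ hzb
    refine ⟨insert b Q, Set.insert_subset hb hQS, Or.inr hx0Q, Or.inl rfl, ⟨?_, ?_⟩, ?_⟩
    · rintro a (rfl | ha) c (rfl | hc) hac
      · rfl
      · linarith [hmax c hc]
      · linarith [hmax a ha]
      · exact hQ.inj a ha c hc hac
    · rintro a (rfl | ha) c (rfl | hc) hac
      · exact absurd hac (lt_irrefl _)
      · linarith [hmax c hc]
      · exact ⟨z, Or.inr hzQ, hzb, hmax a ha, he⟩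
      · obtain ⟨y, hy, hyc⟩ := hQ.step a ha c hc hac
        exact ⟨y, Or.inr hy, hyc⟩
    · rintro q (rfl | hq)
      · exact le_rfl
      · linarith [hmax q hq]

/-- Context in which petals are cut. -/
structure PCtx {V : Type*} (G : SimpleGraph V) (S : Set V) (u : Sym2 V → ℝ)
    (d : V → V → ℝ) (x0 : V) (Q : Set V) (τ : V) : Prop where
  geo : Geo G S u d
  hu : ∀ a b, G.Adj a b → 0 < u s(a, b)
  x0S : x0 ∈ S
  QS : Q ⊆ S
  x0Q : x0 ∈ Q
  hw : HW G u (d x0) Q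
  tQ : τ ∈ Q
  max : ∀ q ∈ Q, d x0 q ≤ d x0 τ

/-- The petal of radius `r` around `τ` along `Q`. -/
def petal {V : Type*} (S : Set V) (d : V → V → ℝ) (x0 : V) (Q : Set V) (τ : V) (r : ℝ) : Set V :=
  {v | v ∈ S ∧ ∃ p ∈ Q, d x0 τ - d x0 p + 2 * (d x0 p + d p v - d x0 v) ≤ r}

section petalfacts
variable {V : Type*} {G : SimpleGraph V} {S : Set V} {u : Sym2 V → ℝ}
  {d : V → V → ℝ} {x0 : V} {Q : Set V} {τ : V}

lemma petal_mono {r r' : ℝ} (h : r ≤ r') : petal S d x0 Q τ r ⊆ petal S d x0 Q τ r' := by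
  rintro v ⟨hv, p, hp, hle⟩
  exact ⟨hv, p, hp, hle.trans h⟩

lemma PCtx.abs (c : PCtx G S u d x0 Q τ) {p v : V} (hp : p ∈ S) (hv : v ∈ S) :
    d x0 v ≤ d x0 p + d p v ∧ d x0 p ≤ d x0 v + d p v := by
  refine ⟨c.geo.tri _ c.x0S _ hp _ hv, ?_⟩
  rw [c.geo.symm p hp v hv]
  exact c.geo.tri _ c.x0S _ hv _ hp

lemma PCtx.mem_Q (c : PCtx G S u d x0 Q τ) {q : V} (hq : q ∈ Q) {r : ℝ} :
    q ∈ petal S d x0 Q τ r ↔ d x0 τ - d x0 q ≤ r := by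
  constructor
  · rintro ⟨hv, p, hp, hle⟩
    obtain ⟨h1, h2⟩ := c.abs (c.QS hp) hv
    rcases le_total (d x0 p) (d x0 q) with h | h <;> linarith
  · intro h
    refine ⟨c.QS hq, q, hq, ?_⟩
    rw [c.geo.self q (c.QS hq)]
    linarith

lemma PCtx.center_not_mem (c : PCtx G S u d x0 Q τ) {r : ℝ} (hr : r < d x0 τ) :
    x0 ∉ petal S d x0 Q τ r := by
  rw [c.mem_Q c.x0Q, c.geo.self _ c.x0S]
  linarith

lemma PCtx.closed (c : PCtx G S u d x0 Q τ) {r : ℝ} {z b : V} (hz : z ∈ petal S d x0 Q τ r)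
    (hb : b ∈ S) (hzb : G.Adj z b) (he : d x0 z + u s(z, b) = d x0 b) :
    b ∈ petal S d x0 Q τ r := by
  obtain ⟨hzS, p, hp, hle⟩ := hz
  refine ⟨hb, p, hp, ?_⟩
  have h1 := c.geo.tri p (c.QS hp) z hzS b hb
  have h2 := c.geo.edge z hzS b hb hzb
  linarith

lemma PCtx.lip (c : PCtx G S u d x0 Q τ) {r s : ℝ} {a b : V} (ha : a ∈ petal S d x0 Q τ r)
    (hb : b ∈ S) (hab : d a b ≤ s) : b ∈ petal S d x0 Q τ (r + 4 * s) := by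
  obtain ⟨haS, p, hp, hle⟩ := ha
  refine ⟨hb, p, hp, ?_⟩
  have h1 := c.geo.tri p (c.QS hp) a haS b hb
  obtain ⟨h2, h3⟩ := c.abs haS hb
  linarith

lemma PCtx.cone_closed (c : PCtx G S u d x0 Q τ) {r : ℝ} {p : V} :
    ∀ z ∈ S, ∀ b ∈ S, b ∈ {v | v ∈ S ∧ d x0 τ - d x0 p + 2 * (d x0 p + d p v - d x0 v) ≤ r} →
      G.Adj z b → d p z + u s(z, b) = d p b →
      z ∈ {v | v ∈ S ∧ d x0 τ - d x0 p + 2 * (d x0 p + d p v - d x0 v) ≤ r} := by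
  rintro z hz b hb ⟨_, hle⟩ hzb he
  refine ⟨hz, ?_⟩
  have h1 := c.geo.tri x0 c.x0S z hz b hb
  have h2 := c.geo.edge z hz b hb hzb
  linarith

end petalfacts

/-! ### Part F: cutting one petal -/

/-- The outcome of cutting a petal `X1` from `S`, leaving `X0`. -/
structure CutOut {V : Type*} (G : SimpleGraph V) (w : Sym2 V → ℝ) (S H : Set V)
    (d : V → V → ℝ) (x0 : V) (s : ℝ) (X0 X1 Mid : Set V) (x y : V) (d0 d1 : V → V → ℝ)
    (H1 : Set V) : Prop where
  x0mem : x0 ∈ X0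
  ymem : y ∈ X0
  xmem : x ∈ X1
  adj : G.Adj y x
  geo0 : Geo G X0 (hwt w (H ∩ X0)) d0
  geo1 : Geo G X1 (hwt w H1) d1
  hw0 : HW G (hwt w (H ∩ X0)) (d0 x0) (H ∩ X0)
  hw1 : HW G (hwt w H1) (d1 x) H1
  H1sub : H1 ⊆ X1
  xH1 : x ∈ H1
  d0eq : ∀ v ∈ X0, d0 x0 v = d x0 v
  attach : (y ∈ H ∧ (∀ v ∈ X1, 2 * d x0 y + w s(y, x) + 4 * d1 x v ≤ 4 * d x0 v) ∧
      (∀ q ∈ H, q ∉ X0 → q ∈ H1 ∧ 2 * d x0 y + w s(y, x) + 2 * d1 x q ≤ 2 * d x0 q)) ∨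
    ((∀ v ∈ X1, 4 * d x0 y + w s(y, x) + 4 * d1 x v ≤ 4 * d x0 v) ∧ H ⊆ X0)
  pad1 : ∀ a ∈ S, a ∈ Mid → a ∈ X1 ∧ ∀ b ∈ S, d a b < s → b ∈ X1 ∧ d1 a b ≤ d a b
  pad0 : ∀ a ∈ S, a ∉ Mid → a ∈ X0 ∧ ∀ b ∈ S, d a b < s → b ∈ X0 ∧ d0 a b ≤ d a b

lemma cut_at {V : Type*} [Finite V] {G : SimpleGraph V} {w : Sym2 V → ℝ} {S H Q : Set V}
    {d : V → V → ℝ} {x0 τ : V} (hwp : ∀ a b, G.Adj a b → 0 < w s(a, b))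
    (c : PCtx G S (hwt w H) d x0 Q τ) (hH : HW G (hwt w H) (d x0) H) (hx0H : x0 ∈ H)
    (hHS : H ⊆ S) {Δ : ℝ} (hΔ : 0 < Δ)
    (hτ : Δ / 2 ≤ d x0 τ)
    (htype : Q = H ∨ (d x0 τ = Δ ∧ ∀ q ∈ H, d x0 q < Δ / 2))
    {rm δ : ℝ} (hrm : 0 ≤ rm) (hδ : 0 < δ) (hrp : rm + δ ≤ Δ / 4) :
    ∃ x y d0 d1 H1, CutOut G w S H d x0 (δ / 8) (S \ petal S d x0 Q τ rm)
      (petal S d x0 Q τ (rm + δ)) (petal S d x0 Q τ (rm + δ / 2)) x y d0 d1 H1 := by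
  have hsub : petal S d x0 Q τ rm ⊆ petal S d x0 Q τ (rm + δ) := petal_mono (by linarith)
  have hx0m : x0 ∉ petal S d x0 Q τ rm := c.center_not_mem (by linarith)
  have hx0p : x0 ∉ petal S d x0 Q τ (rm + δ) := c.center_not_mem (by linarith)
  -- the attachment edge
  obtain ⟨x, ⟨hxQ, hxP⟩, hxmin⟩ := Set.exists_min_image (Q ∩ petal S d x0 Q τ (rm + δ)) (d x0)
    (Set.toFinite _) ⟨τ, c.tQ, (c.mem_Q c.tQ).2 (by linarith)⟩
  have hxS : x ∈ S := c.QS hxQ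
  have hxne : x0 ≠ x := fun h => hx0p (h ▸ hxP)
  have hposx : d x0 x0 < d x0 x := by
    rw [c.geo.self _ c.x0S]; exact c.geo.pos c.hu c.x0S hxS hxne
  obtain ⟨y, hyQ, hyx, -, hye⟩ := c.hw.step x0 c.x0Q x hxQ hposx
  have huyx := c.hu _ _ hyx
  have hyS : y ∈ S := c.QS hyQ
  have hyp : y ∉ petal S d x0 Q τ (rm + δ) := by
    intro h
    have := hxmin y ⟨hyQ, h⟩
    linarith
  have hym : y ∉ petal S d x0 Q τ rm := fun h => hyp (hsub h)
  have hyr : rm + δ < d x0 τ - d x0 y := by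
    rw [c.mem_Q hyQ] at hyp
    linarith
  have hxr := (c.mem_Q hxQ).1 hxP
  -- the piece X0
  have hcl0 : ∀ z ∈ S, ∀ b ∈ S, b ∈ S \ petal S d x0 Q τ rm → G.Adj z b →
      d x0 z + hwt w H s(z, b) = d x0 b → z ∈ S \ petal S d x0 Q τ rm := by
    intro z hz b hb hbX hzb he
    exact ⟨hz, fun h => hbX.2 (c.closed h hb hzb he)⟩
  have hx0X : x0 ∈ S \ petal S d x0 Q τ rm := ⟨c.x0S, hx0m⟩
  have hw0pos : ∀ a b, G.Adj a b → 0 < hwt w (H ∩ (S \ petal S d x0 Q τ rm)) s(a, b) :=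
    fun a b hab => (hwt_bounds w _ (hwp a b hab)).1
  have hw0eq : ∀ a ∈ S \ petal S d x0 Q τ rm, ∀ b ∈ S \ petal S d x0 Q τ rm,
      hwt w (H ∩ (S \ petal S d x0 Q τ rm)) s(a, b) = hwt w H s(a, b) := by
    intro a ha b hb
    exact hwt_congr w ⟨fun h => h.1, fun h => ⟨h, ha⟩⟩ ⟨fun h => h.1, fun h => ⟨h, hb⟩⟩
  obtain ⟨d0, g0⟩ := geo_exists hw0pos (connected_of_reachIn hx0X (fun b hb =>
    c.geo.reach c.hu subset_rfl c.x0S hcl0 b hb.1 hb))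
  have hd0 : ∀ v ∈ S \ petal S d x0 Q τ rm, d0 x0 v = d x0 v := by
    intro v hv
    apply le_antisymm
    · exact c.geo.transfer g0 c.hu (fun a ha b hb _ => (hw0eq a ha b hb).le) subset_rfl c.x0S hx0X
        hcl0 v hv.1 hv
    · refine g0.lower hw0pos hx0X (d x0) (c.geo.self _ c.x0S).le ?_ v hv
      intro z hz b hb hzb
      rw [hw0eq z hz b hb]
      linarith [c.geo.tri x0 c.x0S z hz.1 b hb.1, c.geo.edge z hz.1 b hb.1 hzb]
  -- the piece X1
  set P := petal S d x0 Q τ (rm + δ) with hP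
  have hPS : P ⊆ S := fun v hv => hv.1
  have hup : ∀ a ∈ Q, a ∈ P → ∀ z ∈ Q, d x0 a ≤ d x0 z → z ∈ P := by
    intro a ha haP z hz haz
    rw [hP, c.mem_Q hz]
    rw [hP, c.mem_Q ha] at haP
    linarith
  have hw1pos : ∀ a b, G.Adj a b → 0 < hwt w (Q ∩ P) s(a, b) :=
    fun a b hab => (hwt_bounds w _ (hwp a b hab)).1
  have hmemP : ∀ v ∈ P, ∃ p ∈ Q, p ∈ P ∧
      d x0 τ - d x0 p + 2 * (d x0 p + d p v - d x0 v) ≤ rm + δ := by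
    rintro v ⟨hv, p, hp, hle⟩
    refine ⟨p, hp, ?_, hle⟩
    rw [hP, c.mem_Q hp]
    linarith [(c.abs (c.QS hp) hv).1]
  have hconeP : ∀ p ∈ Q,
      {v | v ∈ S ∧ d x0 τ - d x0 p + 2 * (d x0 p + d p v - d x0 v) ≤ rm + δ} ⊆ P :=
    fun p hp v hv => ⟨hv.1, p, hp, hv.2⟩
  obtain ⟨d1, g1⟩ := geo_exists hw1pos (connected_of_reachIn hxP (fun b hb => by
    obtain ⟨p, hp, hpP, hle⟩ := hmemP b hb
    have r1 := c.hw.reach c.hu hup hxQ hxP p hp (hxmin p ⟨hp, hpP⟩)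
    have r2 := c.geo.reach c.hu (hconeP p hp) (c.QS hp) c.cone_closed b (hPS hb) ⟨hPS hb, hle⟩
    exact r1.trans r2))
  -- type facts
  have hHP : ¬ Q = H → ∀ q ∈ H, q ∉ P := by
    intro hne q hq hqP
    obtain ⟨hT, hlt⟩ := htype.resolve_left hne
    obtain ⟨p, hp, -, hle⟩ := hmemP q hqP
    have h1 := hlt q hq
    obtain ⟨h2, h3⟩ := c.abs (c.QS hp) (hHS hq)
    rw [hT] at hle
    linarith
  obtain ⟨κ, hκ0, hκ1, hκH, hκne, hklow, hkQ, hkup⟩ : ∃ κ : ℝ, 0 < κ ∧ κ ≤ 1 ∧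
      (Q = H → κ = 1) ∧ (¬ Q = H → κ = 1 / 2) ∧
      (∀ a ∈ P, ∀ b ∈ P, G.Adj a b → κ * hwt w H s(a, b) ≤ hwt w (Q ∩ P) s(a, b)) ∧
      (∀ a ∈ Q, a ∈ P → ∀ b ∈ Q, b ∈ P → G.Adj a b →
        hwt w (Q ∩ P) s(a, b) = κ * hwt w H s(a, b)) ∧
      (∀ a ∈ P, ∀ b ∈ P, G.Adj a b → hwt w (Q ∩ P) s(a, b) ≤ hwt w H s(a, b)) := by
    by_cases hQH : Q = H
    · have he : ∀ a ∈ P, ∀ b ∈ P, hwt w (Q ∩ P) s(a, b) = hwt w H s(a, b) := by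
        intro a ha b hb
        exact hwt_congr w ⟨fun h => hQH ▸ h.1, fun h => ⟨hQH ▸ h, ha⟩⟩
          ⟨fun h => hQH ▸ h.1, fun h => ⟨hQH ▸ h, hb⟩⟩
      refine ⟨1, one_pos, le_rfl, fun _ => rfl, fun h => absurd hQH h, ?_, ?_, ?_⟩
      · intro a ha b hb _
        rw [he a ha b hb, one_mul]
      · intro a _ ha b _ hb _
        rw [he a ha b hb, one_mul]
      · intro a ha b hb _
        exact (he a ha b hb).le
    · have he : ∀ a ∈ P, ∀ b, hwt w H s(a, b) = w s(a, b) := by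
        intro a ha b
        exact hwt_of_not w (fun h => hHP hQH a h.1 ha)
      refine ⟨1 / 2, by norm_num, by norm_num, fun h => absurd h hQH, fun _ => rfl, ?_, ?_, ?_⟩
      · intro a ha b hb hab
        rw [he a ha b]
        linarith [(hwt_bounds w (Q ∩ P) (hwp a b hab)).2.2]
      · intro a haQ ha b hbQ hb _
        rw [he a ha b, hwt_of_mem w (H := Q ∩ P) ⟨haQ, ha⟩ ⟨hbQ, hb⟩]
        ring
      · intro a ha b hb hab
        rw [he a ha b]
        exact (hwt_bounds w (Q ∩ P) (hwp a b hab)).2.1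
  have hch : ∀ a ∈ Q, a ∈ P → ∀ b ∈ Q, d x0 a ≤ d x0 b → d1 a b ≤ κ * (d x0 b - d x0 a) :=
    fun a ha haP => c.hw.chain g1 c.hu hup
      (fun a ha haP b hb hbP hab => (hkQ a ha haP b hb hbP hab).le) ha haP
  have hd1Q : ∀ q ∈ Q, q ∈ P → d1 x q = κ * (d x0 q - d x0 x) := by
    intro q hq hqP
    apply le_antisymm (hch x hxQ hxP q hq (hxmin q ⟨hq, hqP⟩))
    refine g1.lower hw1pos hxP (fun v => κ * (d x0 v - d x0 x)) (by simp) ?_ q hqP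
    intro z hz b hb hzb
    have h1 := hklow z hz b hb hzb
    have h2 : d x0 b ≤ d x0 z + hwt w H s(z, b) := by
      linarith [c.geo.tri x0 c.x0S z hz.1 b hb.1, c.geo.edge z hz.1 b hb.1 hzb]
    have h3 := mul_le_mul_of_nonneg_left h2 hκ0.le
    linarith
  -- main estimate on distances from x in X1
  have hd1 : ∀ v ∈ P, ∃ p ∈ Q, p ∈ P ∧ d x0 x ≤ d x0 p ∧
      d1 x v ≤ κ * (d x0 p - d x0 x) + d p v ∧
      d x0 τ - d x0 p + 2 * (d x0 p + d p v - d x0 v) ≤ rm + δ := by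
    intro v hv
    obtain ⟨p, hp, hpP, hle⟩ := hmemP v hv
    refine ⟨p, hp, hpP, hxmin p ⟨hp, hpP⟩, ?_, hle⟩
    have h1 := c.geo.transfer g1 c.hu hkup (hconeP p hp) (c.QS hp) hpP c.cone_closed v
      (hPS hv) ⟨hPS hv, hle⟩
    have h2 := g1.tri x hxP p hpP v hv
    rw [hd1Q p hp hpP] at h2
    linarith
  refine ⟨x, y, d0, d1, Q ∩ P, ⟨hx0X, ⟨hyS, hym⟩, hxP, hyx, g0, g1, ⟨?_, ?_⟩, ⟨?_, ?_⟩,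
    fun v hv => hv.2, ⟨hxQ, hxP⟩, hd0, ?_, ?_, ?_⟩⟩
  · intro a ha b hb hab
    rw [hd0 a ha.2, hd0 b hb.2] at hab
    exact hH.inj a ha.1 b hb.1 hab
  · intro a ha b hb hab
    rw [hd0 a ha.2, hd0 b hb.2] at hab
    obtain ⟨z, hz, hzb, haz, he⟩ := hH.step a ha.1 b hb.1 hab
    have hzX := hcl0 z (hHS hz) b hb.2.1 hb.2 hzb he
    refine ⟨z, ⟨hz, hzX⟩, hzb, ?_, ?_⟩
    · rwa [hd0 a ha.2, hd0 z hzX]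
    · rwa [hd0 z hzX, hd0 b hb.2, hw0eq z hzX b hb.2]
  · intro a ha b hb hab
    rw [hd1Q a ha.1 ha.2, hd1Q b hb.1 hb.2] at hab
    have := mul_left_cancel₀ hκ0.ne' hab
    exact c.hw.inj a ha.1 b hb.1 (by linarith)
  · intro a ha b hb hab
    rw [hd1Q a ha.1 ha.2, hd1Q b hb.1 hb.2] at hab
    have := lt_of_mul_lt_mul_left hab hκ0.le
    obtain ⟨z, hz, hzb, haz, he⟩ := c.hw.step a ha.1 b hb.1 (by linarith)
    have hzP := hup a ha.1 ha.2 z hz haz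
    refine ⟨z, ⟨hz, hzP⟩, hzb, ?_, ?_⟩
    · rw [hd1Q a ha.1 ha.2, hd1Q z hz hzP]
      gcongr
    · rw [hd1Q b hb.1 hb.2, hd1Q z hz hzP, hkQ z hz hzP b hb.1 hb.2 hzb, ← he]
      ring
  · by_cases hQH : Q = H
    · left
      have hk := hκH hQH
      have hwb := (hwt_bounds w H (hwp y x hyx)).2.2
      refine ⟨hQH ▸ hyQ, ?_, ?_⟩
      · intro v hv
        obtain ⟨p, hp, hpP, h1, h2, h3⟩ := hd1 v hv
        rw [hk] at h2
        have h4 := c.max p hp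
        linarith
      · intro q hq hqX
        have hqP : q ∈ P := by
          by_contra h
          exact hqX ⟨hHS hq, fun h' => h (hsub h')⟩
        have hqQ : q ∈ Q := hQH ▸ hq
        refine ⟨⟨hqQ, hqP⟩, ?_⟩
        rw [hd1Q q hqQ hqP, hk]
        linarith
    · right
      have hk := hκne hQH
      have hwe : hwt w H s(y, x) = w s(y, x) :=
        hwt_of_not w (fun h => hHP hQH x h.2 hxP)
      refine ⟨?_, ?_⟩
      · intro v hv
        obtain ⟨p, hp, hpP, h1, h2, h3⟩ := hd1 v hv
        rw [hk] at h2
        rw [hwe] at hye huyx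
        linarith
      · intro q hq
        exact ⟨hHS hq, fun h => hHP hQH q hq (hsub h)⟩
  · intro a haS haM
    have haP : a ∈ P := petal_mono (by linarith) haM
    have key : ∀ b ∈ S, d a b < δ / 8 → b ∈ P := by
      intro b hb hab
      exact petal_mono (by linarith) (c.lip haM hb hab.le)
    refine ⟨haP, fun b hb hab => ⟨key b hb hab, ?_⟩⟩
    refine c.geo.transfer (K := {v | v ∈ S ∧ d a v < δ / 8}) g1 c.hu hkup
      (fun v hv => key v hv.1 hv.2) haS haP ?_ b hb ⟨hb, hab⟩
    intro z hz b' hb' hbK hzb he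
    exact ⟨hz, by have := c.hu _ _ hzb; linarith [hbK.2]⟩
  · intro a haS haM
    have haX : a ∈ S \ petal S d x0 Q τ rm :=
      ⟨haS, fun h => haM (petal_mono (by linarith) h)⟩
    have key : ∀ b ∈ S, d a b < δ / 8 → b ∈ S \ petal S d x0 Q τ rm := by
      intro b hb hab
      refine ⟨hb, fun h => haM ?_⟩
      rw [c.geo.symm a haS b hb] at hab
      exact petal_mono (by linarith) (c.lip h haS hab.le)
    refine ⟨haX, fun b hb hab => ⟨key b hb hab, ?_⟩⟩
    refine c.geo.transfer (K := {v | v ∈ S ∧ d a v < δ / 8}) g0 c.hu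
      (fun a ha b hb _ => (hw0eq a ha b hb).le)
      (fun v hv => key v hv.1 hv.2) haS haX ?_ b hb ⟨hb, hab⟩
    intro z hz b' hb' hbK hzb he
    exact ⟨hz, by have := c.hu _ _ hzb; linarith [hbK.2]⟩

/-! ### Part G: choosing the cut radius -/

/-- The measure of a set of vertices. -/
noncomputable def mS {V : Type*} [Fintype V] (μ : V → ℝ) (S : Set V) : ℝ := ∑ v, S.indicator μ v

lemma mS_mono {V : Type*} [Fintype V] {μ : V → ℝ} (hμ : ∀ v, 1 ≤ μ v) {S S' : Set V}
    (h : S ⊆ S') : mS μ S ≤ mS μ S' :=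
  Finset.sum_le_sum fun v _ =>
    Set.indicator_le_indicator_of_subset h (fun a => zero_le_one.trans (hμ a)) v

lemma mS_ge_one {V : Type*} [Fintype V] {μ : V → ℝ} (hμ : ∀ v, 1 ≤ μ v) {S : Set V} {a : V}
    (h : a ∈ S) : 1 ≤ mS μ S := by
  refine (hμ a).trans ?_
  have := Finset.single_le_sum (f := S.indicator μ)
    (fun v _ => Set.indicator_nonneg (fun a _ => by linarith [hμ a]) v) (Finset.mem_univ a)
  rwa [Set.indicator_of_mem h] at this

lemma mS_diff {V : Type*} [Fintype V] {μ : V → ℝ} {S P : Set V} (h : P ⊆ S) :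
    mS μ (S \ P) = mS μ S - mS μ P := by
  unfold mS
  rw [← Finset.sum_sub_distrib]
  refine Finset.sum_congr rfl fun v _ => ?_
  by_cases h1 : v ∈ S <;> by_cases h2 : v ∈ P
  · simp [h1, h2]
  · simp [h1, h2]
  · exact absurd (h h2) h1
  · simp [h1, h2]

lemma cut_measure {V : Type*} [Fintype V] {G : SimpleGraph V} {w : Sym2 V → ℝ} {S H : Set V}
    {d : V → V → ℝ} {x0 : V} {μ : V → ℝ} (hμ : ∀ v, 1 ≤ μ v)
    (hwp : ∀ a b, G.Adj a b → 0 < w s(a, b))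
    (hgeo : Geo G S (hwt w H) d) (hH : HW G (hwt w H) (d x0) H) (hx0H : x0 ∈ H)
    (hHS : H ⊆ S) {α L : ℝ} {N : ℕ} (hα : 0 < α) (hN1 : 1 ≤ N) (hN : L ≤ (1 + α) ^ N)
    (hL : Real.logb 2 (mS μ S) ≤ L) (hne : ∃ v ∈ S, v ≠ x0) :
    ∃ Δ X0 X1 Mid x y d0 d1 H1, (∀ v ∈ S, d x0 v ≤ Δ) ∧
      CutOut G w S H d x0 (Δ / (64 * N)) X0 X1 Mid x y d0 d1 H1 ∧
      X0 ⊂ S ∧ X1 ⊂ S ∧ (∀ v ∈ S, v ∈ X0 ∨ v ∈ X1) ∧ 0 < Δ ∧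
      mS μ X0 ^ (1 + α) + mS μ X1 ^ (1 + α) ≤ mS μ S ^ (1 + α) := by
  have hx0S := hHS hx0H
  have hu : ∀ a b, G.Adj a b → 0 < hwt w H s(a, b) := fun a b hab => (hwt_bounds w _ (hwp a b hab)).1
  obtain ⟨t, htS, htmax⟩ := Set.exists_max_image S (d x0) (Set.toFinite _) ⟨x0, hx0S⟩
  obtain ⟨v0, hv0, hv0ne⟩ := hne
  have hΔ : 0 < d x0 t := (hgeo.pos hu hx0S hv0 hv0ne.symm).trans_le (htmax v0 hv0)
  set Δ := d x0 t with hΔdef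
  obtain ⟨Q, τ, c, hτ, htype⟩ : ∃ Q τ, PCtx G S (hwt w H) d x0 Q τ ∧ Δ / 2 ≤ d x0 τ ∧
      (Q = H ∨ (d x0 τ = Δ ∧ ∀ q ∈ H, d x0 q < Δ / 2)) := by
    obtain ⟨h, hhH, hhmax⟩ := Set.exists_max_image H (d x0) (Set.toFinite _) ⟨x0, hx0H⟩
    rcases le_or_gt (Δ / 2) (d x0 h) with hle | hlt
    · exact ⟨H, h, ⟨hgeo, hu, hx0S, hHS, hx0H, hH, hhH, hhmax⟩, hle, Or.inl rfl⟩
    · obtain ⟨Q, hQS, hxQ, htQ, hQ, hmax⟩ := HW.exists_path hgeo hu hx0S t htS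
      exact ⟨Q, t, ⟨hgeo, hu, hx0S, hQS, hxQ, hQ, htQ, hmax⟩, by linarith,
        Or.inr ⟨rfl, fun q hq => (hhmax q hq).trans_lt hlt⟩⟩
  have hNpos : (0 : ℝ) < N := by exact_mod_cast hN1
  have hδ : 0 < Δ / (8 * N) := by positivity
  set δ := Δ / (8 * N) with hδdef
  have hδN : δ * (2 * N) = Δ / 4 := by
    rw [hδdef]; field_simp; norm_num
  have hle : ∀ i : ℕ, i ≤ 2 * N → (i : ℝ) * δ ≤ Δ / 4 := by
    intro i hi
    have : (i : ℝ) ≤ 2 * N := by exact_mod_cast hi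
    nlinarith
  have hx0not : ∀ i : ℕ, i ≤ 2 * N → x0 ∉ petal S d x0 Q τ (i * δ) := by
    intro i hi
    exact c.center_not_mem (by linarith [hle i hi])
  have hτmem : ∀ i : ℕ, τ ∈ petal S d x0 Q τ (i * δ) := by
    intro i
    rw [c.mem_Q c.tQ, sub_self]
    positivity
  have hPS : ∀ r, petal S d x0 Q τ r ⊆ S := fun r v hv => hv.1
  obtain ⟨i, hi, hsel⟩ := select_radius α L (mS μ S) N hα hL hN1 hN
    (fun i => mS μ (petal S d x0 Q τ (i * δ)))
    (by
      intro i j hij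
      apply mS_mono hμ
      apply petal_mono
      have : (i : ℝ) ≤ j := by exact_mod_cast hij
      gcongr)
    (mS_ge_one hμ (hτmem 0))
    (by
      have h1 := mS_diff (μ := μ) (hPS (((2 * N : ℕ) : ℝ) * δ))
      have h2 := mS_ge_one hμ (S := S \ petal S d x0 Q τ (((2 * N : ℕ) : ℝ) * δ))
        ⟨hx0S, hx0not _ le_rfl⟩
      show mS μ (petal S d x0 Q τ (((2 * N : ℕ) : ℝ) * δ)) ≤ _
      linarith)
  have hi1 := hle (i + 1) hi
  have hcast : ((i + 1 : ℕ) : ℝ) * δ = i * δ + δ := by push_cast; ring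
  have hx1 := hx0not (i + 1) hi
  rw [hcast] at hi1 hx1
  obtain ⟨x, y, d0, d1, H1, hcut⟩ := cut_at hwp c hH hx0H hHS hΔ hτ htype
    (rm := i * δ) (δ := δ) (by positivity) hδ hi1
  have hs : δ / 8 = Δ / (64 * N) := by
    rw [hδdef]; field_simp; norm_num
  rw [hs] at hcut
  refine ⟨Δ, _, _, _, x, y, d0, d1, H1, htmax, hcut, ?_, ?_, ?_, hΔ, ?_⟩
  · exact ⟨Set.sdiff_subset, fun h => (h (c.QS c.tQ)).2 (hτmem i)⟩
  · exact ⟨hPS _, fun h => hx1 (h hx0S)⟩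
  · intro v hv
    by_cases h : v ∈ petal S d x0 Q τ (i * δ)
    · exact Or.inr (petal_mono (by linarith) h)
    · exact Or.inl ⟨hv, h⟩
  · rw [mS_diff (hPS _), ← hcast]
    linarith

/-! ### Part H: the main induction -/

/-- The properties of the tree built for a cluster `S` with center `x0` and highway `H`. -/
structure Good {V Y : Type} [Fintype V] [Fintype Y] (G : SimpleGraph V) (w : Sym2 V → ℝ)
    (μ : V → ℝ) (S H : Set V) (d : V → V → ℝ) (x0 : V) (α K : ℝ) (T : SimpleGraph Y)
    (π : Y → V) (root : Y) (χ : V → Y) : Prop where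
  tree : T.IsTree
  adj : ∀ a b, T.Adj a b → G.Adj (π a) (π b)
  proot : π root = x0
  pS : ∀ y, π y ∈ S
  surj : ∀ v ∈ S, ∃ y, π y = v
  rad : ∀ y, spDist T (fun e => w (e.map π)) root y ≤ 4 * d x0 (π y)
  hwy : ∀ q ∈ H, ∃ y, π y = q ∧ spDist T (fun e => w (e.map π)) root y ≤ 2 * d x0 q
  chi : ∀ x ∈ S, π (χ x) = x
  dist : ∀ x ∈ S, ∀ y ∈ S, ∃ y', π y' = y ∧
    spDist T (fun e => w (e.map π)) y' (χ x) ≤ K * d x y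
  size : ∑ y, μ (π y) ≤ mS μ S ^ (1 + α)

lemma pull_pos {V Y : Type} {G : SimpleGraph V} {w : Sym2 V → ℝ}
    (hwp : ∀ a b, G.Adj a b → 0 < w s(a, b)) {T : SimpleGraph Y} {π : Y → V}
    (h : ∀ a b, T.Adj a b → G.Adj (π a) (π b)) :
    ∀ e ∈ T.edgeSet, 0 < (fun e : Sym2 Y => w (e.map π)) e := by
  intro e
  induction e with
  | _ a b =>
    intro hab
    exact hwp _ _ (h a b hab)

lemma good_base {V : Type} [Fintype V] {G : SimpleGraph V} {w : Sym2 V → ℝ}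
    {S H : Set V} {d : V → V → ℝ} {x0 : V} {μ : V → ℝ} (hμ : ∀ v, 1 ≤ μ v)
    (hgeo : Geo G S (hwt w H) d) (hx0H : x0 ∈ H)
    (hHS : H ⊆ S) {α K : ℝ} (hα : 0 < α) (hne : ∀ v ∈ S, v = x0) :
    Good G w μ S H d x0 α K (⊥ : SimpleGraph Unit) (fun _ => x0) () (fun _ => ()) := by
  have hx0S := hHS hx0H
  have h0 := hgeo.self x0 hx0S
  have hpos : ∀ e ∈ (⊥ : SimpleGraph Unit).edgeSet,
      0 < (fun e : Sym2 Unit => w (e.map (fun _ => x0))) e := by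
    intro e he
    simp at he
  have hs := spDist_self hpos ()
  refine ⟨SimpleGraph.IsTree.of_subsingleton, ?_, rfl, fun _ => hx0S, ?_, ?_, ?_, ?_, ?_, ?_⟩
  · intro a b h
    exact absurd h (by simp)
  · intro v hv
    exact ⟨(), (hne v hv).symm⟩
  · intro y
    rw [h0]; exact hs.le.trans (by norm_num)
  · intro q hq
    obtain rfl := hne q (hHS hq)
    refine ⟨(), rfl, ?_⟩
    rw [h0]; exact hs.le.trans (by norm_num)
  · intro x hx
    exact (hne x hx).symm
  · intro x hx y hy
    obtain rfl := hne x hx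
    obtain rfl := hne y hy
    refine ⟨(), rfl, ?_⟩
    rw [h0]; exact hs.le.trans (by simp)
  · have h1 : mS μ S = μ x0 := by
      unfold mS
      rw [Finset.sum_eq_single x0]
      · exact Set.indicator_of_mem hx0S μ
      · intro b _ hb
        exact Set.indicator_of_notMem (fun h => hb (hne b h)) μ
      · intro h
        exact absurd (Finset.mem_univ x0) h
    rw [h1]
    simp only [Finset.univ_unique, Finset.sum_const, Finset.card_singleton, one_smul]
    calc μ x0 = μ x0 ^ (1 : ℝ) := (Real.rpow_one _).symm
      _ ≤ μ x0 ^ (1 + α) := Real.rpow_le_rpow_of_exponent_le (hμ x0) (by linarith)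

lemma good_step {V Y0 Y1 : Type} [Fintype V] [Fintype Y0] [Fintype Y1] {G : SimpleGraph V}
    {w : Sym2 V → ℝ} {S H : Set V} {d : V → V → ℝ} {x0 : V} {μ : V → ℝ}
    (hwp : ∀ a b, G.Adj a b → 0 < w s(a, b))
    (hgeo : Geo G S (hwt w H) d) (hx0S : x0 ∈ S) {α Δ : ℝ} {N : ℕ} (hN1 : 1 ≤ N)
    {X0 X1 Mid : Set V} {x y : V} {d0 d1 : V → V → ℝ} {H1 : Set V}
    (hmax : ∀ v ∈ S, d x0 v ≤ Δ)
    (c : CutOut G w S H d x0 (Δ / (64 * N)) X0 X1 Mid x y d0 d1 H1)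
    (hX0 : X0 ⊆ S) (hX1 : X1 ⊆ S) (hcov : ∀ v ∈ S, v ∈ X0 ∨ v ∈ X1)
    (hΔ : 0 < Δ)
    (hm : mS μ X0 ^ (1 + α) + mS μ X1 ^ (1 + α) ≤ mS μ S ^ (1 + α))
    {T0 : SimpleGraph Y0} {π0 : Y0 → V} {root0 : Y0} {χ0 : V → Y0}
    {T1 : SimpleGraph Y1} {π1 : Y1 → V} {root1 : Y1} {χ1 : V → Y1}
    (g0 : Good G w μ X0 (H ∩ X0) d0 x0 α (512 * N) T0 π0 root0 χ0)
    (g1 : Good G w μ X1 H1 d1 x α (512 * N) T1 π1 root1 χ1) :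
    ∃ (T : SimpleGraph (Y0 ⊕ Y1)) (χ : V → Y0 ⊕ Y1),
      Good G w μ S H d x0 α (512 * N) T (Sum.elim π0 π1) (Sum.inl root0) χ := by
  classical
  have hNpos : (0 : ℝ) < N := by exact_mod_cast hN1
  have p0 := pull_pos hwp g0.adj
  have p1 := pull_pos hwp g1.adj
  -- the attachment copy
  obtain ⟨z, hz, hzr, hzq⟩ : ∃ z, π0 z = y ∧
      (∀ v ∈ X1, spDist T0 (fun e => w (e.map π0)) root0 z + w s(y, x) + 4 * d1 x v
        ≤ 4 * d x0 v) ∧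
      (∀ q ∈ H, q ∉ X0 → q ∈ H1 ∧
        spDist T0 (fun e => w (e.map π0)) root0 z + w s(y, x) + 2 * d1 x q ≤ 2 * d x0 q) := by
    have hd0y := c.d0eq y c.ymem
    rcases c.attach with ⟨hyH, ha, hb⟩ | ⟨ha, hb⟩
    · obtain ⟨z, hz, hzd⟩ := g0.hwy y ⟨hyH, c.ymem⟩
      rw [hd0y] at hzd
      refine ⟨z, hz, fun v hv => ?_, fun q hq hqX => ⟨(hb q hq hqX).1, ?_⟩⟩
      · linarith [ha v hv]
      · linarith [(hb q hq hqX).2]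
    · obtain ⟨z, hz⟩ := g0.surj y c.ymem
      have hzd := g0.rad z
      rw [hz, hd0y] at hzd
      refine ⟨z, hz, fun v hv => ?_, fun q hq hqX => absurd (hb hq) hqX⟩
      linarith [ha v hv]
  set T := T0.sum T1 ⊔ SimpleGraph.edge (Sum.inl z) (Sum.inr root1) with hT
  set π : Y0 ⊕ Y1 → V := Sum.elim π0 π1 with hπ
  have htree : T.IsTree := isTree_join g0.tree g1.tree z root1
  have hadj : ∀ a b, T.Adj a b → G.Adj (π a) (π b) := by
    intro a b hab
    rw [hT, SimpleGraph.sup_adj, SimpleGraph.edge_adj] at hab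
    rcases hab with hab | ⟨⟨rfl, rfl⟩ | ⟨rfl, rfl⟩, -⟩
    · rcases a with a | a <;> rcases b with b | b
      · exact g0.adj a b (by simpa using hab)
      · simp at hab
      · simp at hab
      · exact g1.adj a b (by simpa using hab)
    · simp only [hπ, Sum.elim_inl, Sum.elim_inr, hz, g1.proot]
      exact c.adj
    · simp only [hπ, Sum.elim_inl, Sum.elim_inr, hz, g1.proot]
      exact c.adj.symm
  have p := pull_pos hwp hadj
  have i0 : ∀ a b, spDist T (fun e => w (e.map π)) (Sum.inl a) (Sum.inl b) ≤
      spDist T0 (fun e => w (e.map π0)) a b := by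
    intro a b
    refine spDist_map_le g0.tree.connected p (⟨Sum.inl, ?_⟩ : T0 →g T) ?_ a b
    · intro a b hab
      rw [hT, SimpleGraph.sup_adj]
      left
      simpa using hab
    · intro e
      simp only [Sym2.map_map]
      rfl
  have i1 : ∀ a b, spDist T (fun e => w (e.map π)) (Sum.inr a) (Sum.inr b) ≤
      spDist T1 (fun e => w (e.map π1)) a b := by
    intro a b
    refine spDist_map_le g1.tree.connected p (⟨Sum.inr, ?_⟩ : T1 →g T) ?_ a b
    · intro a b hab
      rw [hT, SimpleGraph.sup_adj]
      left
      simpa using hab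
    · intro e
      simp only [Sym2.map_map]
      rfl
  have hedge : spDist T (fun e => w (e.map π)) (Sum.inl z) (Sum.inr root1) ≤ w s(y, x) := by
    have h1 : T.Adj (Sum.inl z) (Sum.inr root1) := by
      rw [hT, SimpleGraph.sup_adj, SimpleGraph.edge_adj]
      right
      simp
    have := spDist_edge p h1
    simpa [hπ, hz, g1.proot] using this
  have hcross : ∀ b, spDist T (fun e => w (e.map π)) (Sum.inl root0) (Sum.inr b) ≤
      spDist T0 (fun e => w (e.map π0)) root0 z + w s(y, x)
        + spDist T1 (fun e => w (e.map π1)) root1 b := by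
    intro b
    have h1 := spDist_tri htree.connected p (Sum.inl root0) (Sum.inl z) (Sum.inr b)
    have h2 := spDist_tri htree.connected p (Sum.inl z) (Sum.inr root1) (Sum.inr b)
    linarith [i0 root0 z, i1 root1 b]
  have hpS : ∀ a, π a ∈ S := by
    rintro (a | a)
    · exact hX0 (g0.pS a)
    · exact hX1 (g1.pS a)
  have hrad : ∀ a, spDist T (fun e => w (e.map π)) (Sum.inl root0) a ≤ 4 * d x0 (π a) := by
    rintro (a | a)
    · have := g0.rad a
      rw [c.d0eq _ (g0.pS a)] at this
      exact (i0 root0 a).trans this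
    · have h1 := hcross a
      have h2 := g1.rad a
      have h3 := hzr _ (g1.pS a)
      simp only [hπ, Sum.elim_inr] at *
      linarith
  have hsurj : ∀ v ∈ S, ∃ a, π a = v := by
    intro v hv
    rcases hcov v hv with h | h
    · obtain ⟨a, ha⟩ := g0.surj v h
      exact ⟨Sum.inl a, ha⟩
    · obtain ⟨a, ha⟩ := g1.surj v h
      exact ⟨Sum.inr a, ha⟩
  refine ⟨T, fun v => if v ∈ Mid then Sum.inr (χ1 v) else Sum.inl (χ0 v), htree, hadj, g0.proot,
    hpS, hsurj, hrad, ?_, ?_, ?_, ?_⟩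
  · intro q hq
    by_cases hqX : q ∈ X0
    · obtain ⟨a, ha, hd⟩ := g0.hwy q ⟨hq, hqX⟩
      rw [c.d0eq q hqX] at hd
      exact ⟨Sum.inl a, ha, (i0 _ _).trans hd⟩
    · obtain ⟨hq1, hqd⟩ := hzq q hq hqX
      obtain ⟨a, ha, hd⟩ := g1.hwy q hq1
      refine ⟨Sum.inr a, ha, ?_⟩
      linarith [hcross a]
  · intro v hv
    by_cases hM : v ∈ Mid
    · simp only [hM, if_true, hπ, Sum.elim_inr]
      exact g1.chi v (c.pad1 v hv hM).1
    · simp only [hM, if_false, hπ, Sum.elim_inl]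
      exact g0.chi v (c.pad0 v hv hM).1
  · intro a ha b hb
    by_cases hab : d a b < Δ / (64 * N)
    · by_cases hM : a ∈ Mid
      · obtain ⟨haX, hpad⟩ := c.pad1 a ha hM
        obtain ⟨hbX, hle⟩ := hpad b hb hab
        obtain ⟨b', hb', hd⟩ := g1.dist a haX b hbX
        refine ⟨Sum.inr b', hb', ?_⟩
        simp only [hM, if_true]
        refine ((i1 _ _).trans hd).trans ?_
        gcongr
      · obtain ⟨haX, hpad⟩ := c.pad0 a ha hM
        obtain ⟨hbX, hle⟩ := hpad b hb hab
        obtain ⟨b', hb', hd⟩ := g0.dist a haX b hbX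
        refine ⟨Sum.inl b', hb', ?_⟩
        simp only [hM, if_false]
        refine ((i0 _ _).trans hd).trans ?_
        gcongr
    · obtain ⟨b', hb'⟩ := hsurj b hb
      refine ⟨b', hb', ?_⟩
      generalize (if a ∈ Mid then Sum.inr (χ1 a) else Sum.inl (χ0 a) : Y0 ⊕ Y1) = a'
      have h1 := spDist_tri htree.connected p b' (Sum.inl root0) a'
      rw [spDist_symm htree.connected p b' (Sum.inl root0)] at h1
      have h2 := hrad b'
      have h3 := hrad a'
      have h4 := hmax _ (hpS a')
      have h5 := hmax _ (hpS b')
      have h6 : Δ ≤ d a b * (64 * N) := (div_le_iff₀ (by positivity)).1 (not_lt.1 hab)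
      linarith
  · rw [Fintype.sum_sum_type]
    simp only [hπ, Sum.elim_inl, Sum.elim_inr]
    linarith [g0.size, g1.size]

lemma good_exists {V : Type} [Fintype V] {G : SimpleGraph V} {w : Sym2 V → ℝ}
    {μ : V → ℝ} (hμ : ∀ v, 1 ≤ μ v) (hwp : ∀ a b, G.Adj a b → 0 < w s(a, b))
    {α L : ℝ} {N : ℕ} (hα : 0 < α) (hN1 : 1 ≤ N) (hN : L ≤ (1 + α) ^ N) (k : ℕ) :
    ∀ (S H : Set V) (d : V → V → ℝ) (x0 : V), S.ncard ≤ k → Geo G S (hwt w H) d →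
      HW G (hwt w H) (d x0) H → x0 ∈ H → H ⊆ S → Real.logb 2 (mS μ S) ≤ L →
      ∃ (Y : Type) (_ : Fintype Y) (T : SimpleGraph Y) (π : Y → V) (root : Y) (χ : V → Y),
        Good G w μ S H d x0 α (512 * N) T π root χ := by
  induction k with
  | zero =>
    intro S H d x0 hk _ _ hx0H hHS
    have : S.ncard ≠ 0 := Set.ncard_ne_zero_of_mem (hHS hx0H)
    omega
  | succ k ih =>
    intro S H d x0 hk hgeo hH hx0H hHS hL
    by_cases hne : ∃ v ∈ S, v ≠ x0
    · obtain ⟨Δ, X0, X1, Mid, x, y, d0, d1, H1, hmax, c, hX0, hX1, hcov, hΔ, hm⟩ :=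
        cut_measure hμ hwp hgeo hH hx0H hHS hα hN1 hN hL hne
      have hlog : ∀ X : Set V, X ⊆ S → X.Nonempty → Real.logb 2 (mS μ X) ≤ L := by
        rintro X hX ⟨v, hv⟩
        refine le_trans ?_ hL
        exact Real.logb_le_logb_of_le one_lt_two (by linarith [mS_ge_one hμ hv]) (mS_mono hμ hX)
      have hc0 := Set.ncard_lt_ncard hX0 (Set.toFinite S)
      have hc1 := Set.ncard_lt_ncard hX1 (Set.toFinite S)
      obtain ⟨Y0, _, T0, π0, r0, χ0, g0⟩ := ih X0 (H ∩ X0) d0 x0 (by omega) c.geo0 c.hw0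
        ⟨hx0H, c.x0mem⟩ Set.inter_subset_right (hlog X0 hX0.1 ⟨_, c.x0mem⟩)
      obtain ⟨Y1, _, T1, π1, r1, χ1, g1⟩ := ih X1 H1 d1 x (by omega) c.geo1 c.hw1
        c.xH1 c.H1sub (hlog X1 hX1.1 ⟨_, c.xmem⟩)
      obtain ⟨T, χ, g⟩ := good_step hwp hgeo (hHS hx0H) hN1 hmax c hX0.1 hX1.1 hcov hΔ hm g0 g1
      exact ⟨Y0 ⊕ Y1, inferInstance, T, _, _, χ, g⟩
    · push Not at hne
      exact ⟨Unit, inferInstance, _, _, _, _, good_base hμ hgeo hx0H hHS hα hne⟩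

/-! ### Part I: the weighted deterministic statement -/

lemma params (n : ℕ) (hn : 2 ≤ n) (ε : ℝ) (hε : 0 < ε) (hε1 : ε ≤ 1) :
    ∃ (α L : ℝ) (N : ℕ), 0 < α ∧ 1 ≤ N ∧ L ≤ (1 + α) ^ N ∧ Real.logb 2 (2 * n) ≤ L ∧
      (2 * n : ℝ) ^ (1 + α) ≤ 2 * n * (1 + ε / 4) ∧
      (512 * N : ℝ) ≤ 8192 * Real.logb 2 n * (1 + Real.logb 2 (Real.logb 2 n)) / ε := by
  have hn' : (2 : ℝ) ≤ n := by exact_mod_cast hn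
  have hn0 : (0 : ℝ) < n := by linarith
  set l := Real.logb 2 n with hl
  have hl1 : 1 ≤ l := by
    rw [hl, Real.le_logb_iff_rpow_le one_lt_two hn0]
    simpa using hn'
  have hLl : Real.logb 2 (2 * n) = 1 + l := by
    rw [Real.logb_mul two_ne_zero hn0.ne', Real.logb_self_eq_one one_lt_two]
  set L := 1 + l with hL
  have hL2 : 2 ≤ L := by linarith
  have hL0 : 0 < L := by linarith
  set α := ε / (4 * L) with hα
  have hα0 : 0 < α := by positivity
  have hα1 : α ≤ 1 := by
    rw [hα, div_le_one (by positivity)]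
    linarith
  have hlog1 : 1 ≤ Real.logb 2 L := by
    rw [Real.le_logb_iff_rpow_le one_lt_two hL0]
    simpa using hL2
  have hlog2 : Real.logb 2 L ≤ 1 + Real.logb 2 l := by
    have h1 : 1 + Real.logb 2 l = Real.logb 2 (2 * l) := by
      rw [Real.logb_mul two_ne_zero (by linarith), Real.logb_self_eq_one one_lt_two]
    rw [h1]
    exact Real.logb_le_logb_of_le one_lt_two hL0 (by linarith)
  have hbern : ∀ p : ℝ, 0 ≤ p → p ≤ 1 → (2 : ℝ) ^ p ≤ 1 + p := by
    intro p h0 h1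
    have := rpow_one_add_le_one_add_mul_self (s := 1) (by norm_num) h0 h1
    norm_num at this
    exact this
  have hq : 1 ≤ Real.logb 2 L / α := by
    rw [le_div_iff₀ hα0]
    linarith
  refine ⟨α, L, ⌈Real.logb 2 L / α⌉₊, hα0, ?_, ?_, hLl.le, ?_, ?_⟩
  · exact Nat.one_le_ceil_iff.2 (by linarith)
  · have h1 : Real.logb 2 L / α ≤ (⌈Real.logb 2 L / α⌉₊ : ℝ) := Nat.le_ceil _
    generalize ⌈Real.logb 2 L / α⌉₊ = N at h1
    rw [div_le_iff₀ hα0] at h1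
    calc L = (2 : ℝ) ^ Real.logb 2 L := (Real.rpow_logb two_pos (by norm_num) hL0).symm
      _ ≤ (2 : ℝ) ^ (α * N) := Real.rpow_le_rpow_of_exponent_le one_le_two (by linarith)
      _ = ((2 : ℝ) ^ α) ^ N := by rw [Real.rpow_mul two_pos.le, Real.rpow_natCast]
      _ ≤ (1 + α) ^ N := by
        gcongr
        exact hbern α hα0.le hα1
  · rw [Real.rpow_add (by positivity), Real.rpow_one]
    gcongr
    have h1 : (2 * n : ℝ) = (2 : ℝ) ^ L := by
      rw [← hLl, Real.rpow_logb two_pos (by norm_num) (by positivity)]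
    rw [h1, ← Real.rpow_mul two_pos.le]
    have h2 : L * α = ε / 4 := by
      rw [hα]; field_simp
    rw [h2]
    exact hbern _ (by positivity) (by linarith)
  · have h1 : (⌈Real.logb 2 L / α⌉₊ : ℝ) < Real.logb 2 L / α + 1 :=
      Nat.ceil_lt_add_one (by linarith)
    have h2 : Real.logb 2 L / α = 4 * (L * Real.logb 2 L) / ε := by
      rw [hα]; field_simp
    have h3 : L * Real.logb 2 L ≤ 2 * l * (1 + Real.logb 2 l) :=
      mul_le_mul (by linarith) hlog2 (by linarith) (by linarith)
    calc (512 * (⌈Real.logb 2 L / α⌉₊ : ℝ)) ≤ 1024 * (Real.logb 2 L / α) := by linarith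
      _ = 4096 * (L * Real.logb 2 L) / ε := by rw [h2]; ring
      _ ≤ 4096 * (2 * l * (1 + Real.logb 2 l)) / ε := by gcongr
      _ = _ := by ring

/-- The clan-size vectors of spanning clan embeddings with distortion `t`. -/
def sizeVecs {V : Type} (G : SimpleGraph V) (w : Sym2 V → ℝ) (t : ℝ) : Set (V → ℝ) :=
  {s | ∃ (Y : Type) (_ : Fintype Y) (T : SimpleGraph Y) (wT : Sym2 Y → ℝ) (f : V → Finset Y)
    (χ : V → Y), IsSpanningClanTree G w T wT f χ t ∧ ∀ v, s v = ((f v).card : ℝ)}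

lemma weighted_exists {V : Type} [Fintype V] {G : SimpleGraph V} {w : Sym2 V → ℝ}
    (hn : 2 ≤ Fintype.card V) (hG : G.Connected) (hw : ∀ e ∈ G.edgeSet, 0 < w e)
    {ε : ℝ} (hε : 0 < ε) (hε1 : ε ≤ 1) (lam : V → ℝ) (hlam : ∀ v, 0 ≤ lam v)
    (hsum : ∑ v, lam v = 1) :
    ∃ s ∈ sizeVecs G w (8192 * Real.logb 2 (Fintype.card V) *
        (1 + Real.logb 2 (Real.logb 2 (Fintype.card V))) / ε),
      ∑ v, lam v * s v ≤ 1 + ε / 2 := by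
  classical
  obtain ⟨α, L, N, hα, hN1, hN, hL, hA, hD⟩ := params (Fintype.card V) hn ε hε hε1
  set n := Fintype.card V with hndef
  have hn0 : (0 : ℝ) < n := by
    have : (2 : ℝ) ≤ n := by exact_mod_cast hn
    linarith
  set μ : V → ℝ := fun v => 1 + n * lam v with hμdef
  have hμ : ∀ v, 1 ≤ μ v := fun v => by
    have := mul_nonneg hn0.le (hlam v)
    simp only [hμdef]
    linarith
  have hwp : ∀ a b, G.Adj a b → 0 < w s(a, b) := fun a b h => hw _ h
  have hmu : mS μ Set.univ = 2 * n := by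
    simp only [mS, Set.indicator_univ, hμdef, Finset.sum_add_distrib, ← Finset.mul_sum, hsum]
    simp
    ring
  obtain ⟨x0⟩ := hG.nonempty
  have hhw : ∀ a b, G.Adj a b → hwt w {x0} s(a, b) = w s(a, b) := by
    intro a b hab
    apply hwt_of_not
    rintro ⟨h1, h2⟩
    exact hab.ne (h1.trans h2.symm)
  have hgeo : Geo G Set.univ (hwt w {x0}) (spDist G w) := by
    refine ⟨fun a _ => spDist_self hw a, fun a _ b _ => spDist_symm hG hw a b,
      fun a _ b _ c _ => spDist_tri hG hw a b c, ?_, ?_⟩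
    · intro a _ b _ hab
      rw [hhw a b hab]
      exact spDist_edge hw hab
    · intro a _ b _ hab
      obtain ⟨z, hz, he⟩ := spDist_pred hG hw hab
      exact ⟨z, trivial, hz, by rw [hhw z b hz]; exact he⟩
  have hHW : HW G (hwt w {x0}) (spDist G w x0) {x0} := by
    refine ⟨?_, ?_⟩
    · rintro a rfl b rfl _
      rfl
    · rintro a rfl b rfl h
      exact absurd h (lt_irrefl _)
  obtain ⟨Y, _, T, π, root, χ, g⟩ := good_exists hμ hwp hα hN1 hN _ Set.univ {x0} (spDist G w) x0
    le_rfl hgeo hHW rfl (Set.subset_univ _) (by rw [hmu]; exact hL)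
  have hpos := pull_pos hwp g.adj
  refine ⟨fun v => ((Finset.univ.filter (fun y => π y = v)).card : ℝ),
    ⟨Y, inferInstance, T, fun e => w (e.map π), fun v => Finset.univ.filter (fun y => π y = v), χ,
      ⟨g.tree, hpos, ?_, ?_, ?_, ?_, ?_, ?_, ?_⟩, fun v => rfl⟩, ?_⟩
  · intro v
    obtain ⟨y, hy⟩ := g.surj v trivial
    exact ⟨y, by simpa using hy⟩
  · intro u v huv
    rw [Finset.disjoint_left]
    intro y hy hy'
    simp only [Finset.mem_filter, Finset.mem_univ, true_and] at hy hy'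
    exact huv (hy.symm.trans hy')
  · intro y
    exact ⟨π y, by simp⟩
  · intro u v u' v' hu hv hadj
    simp only [Finset.mem_filter, Finset.mem_univ, true_and] at hu hv
    subst hu hv
    exact ⟨g.adj _ _ hadj, rfl⟩
  · intro u v _ u' hu v' hv
    simp only [Finset.mem_filter, Finset.mem_univ, true_and] at hu hv
    subst hu hv
    exact spDist_map_le g.tree.connected hw (⟨π, fun {a b} h => g.adj a b h⟩ : T →g G)
      (fun e => rfl) u' v'
  · intro v
    simpa using g.chi v trivial
  · intro u v
    obtain ⟨y, hy, hd⟩ := g.dist u trivial v trivial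
    refine ⟨y, by simpa using hy, hd.trans ?_⟩
    exact mul_le_mul_of_nonneg_right hD (spDist_nonneg hw u v)
  · have hsize := g.size
    rw [hmu] at hsize
    have h1 : ∑ y, μ (π y) = ∑ v, ((Finset.univ.filter (fun y => π y = v)).card : ℝ) * μ v := by
      rw [← Finset.sum_fiberwise_of_maps_to (s := Finset.univ) (t := Finset.univ) (g := π)
        (fun _ _ => Finset.mem_univ _)]
      refine Finset.sum_congr rfl fun v _ => ?_
      rw [Finset.sum_congr rfl (g := fun _ => μ v)]
      · simp
      · intro y hy
        rw [(Finset.mem_filter.1 hy).2]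
    have h2 : ∑ v, ((Finset.univ.filter (fun y => π y = v)).card : ℝ) * μ v =
        ∑ v, ((Finset.univ.filter (fun y => π y = v)).card : ℝ) +
          n * ∑ v, lam v * ((Finset.univ.filter (fun y => π y = v)).card : ℝ) := by
      rw [Finset.mul_sum, ← Finset.sum_add_distrib]
      refine Finset.sum_congr rfl fun v _ => ?_
      simp only [hμdef]
      ring
    have h3 : (n : ℝ) ≤ ∑ v, ((Finset.univ.filter (fun y => π y = v)).card : ℝ) := by
      calc (n : ℝ) = ∑ _v : V, (1 : ℝ) := by simp [hndef]
        _ ≤ _ := by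
          refine Finset.sum_le_sum fun v _ => ?_
          obtain ⟨y, hy⟩ := g.surj v trivial
          have : 0 < (Finset.univ.filter (fun y => π y = v)).card :=
            Finset.card_pos.2 ⟨y, by simpa using hy⟩
          exact_mod_cast this
    have h4 : n * ∑ v, lam v * ((Finset.univ.filter (fun y => π y = v)).card : ℝ)
        ≤ n * (1 + ε / 2) := by linarith
    exact le_of_mul_le_mul_left h4 hn0

/-! ### Part J: minimax -/

lemma minimax {V : Type} [Fintype V] [Nonempty V] (A : Set (V → ℝ)) {a b : ℝ} (ha : 0 < a)
    (hab : a < b)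
    (h : ∀ lam : V → ℝ, (∀ v, 0 ≤ lam v) → ∑ v, lam v = 1 → ∃ s ∈ A, ∑ v, lam v * s v ≤ a) :
    ∃ s ∈ convexHull ℝ A, ∀ v, s v < b := by
  classical
  by_contra hcon
  push Not at hcon
  have hO : IsOpen (Set.univ.pi fun _ : V => Set.Iio b) :=
    isOpen_set_pi Set.finite_univ fun _ _ => isOpen_Iio
  have hC : Convex ℝ (Set.univ.pi fun _ : V => Set.Iio b) :=
    convex_pi fun _ _ => convex_Iio b
  have hdis : Disjoint (Set.univ.pi fun _ : V => Set.Iio b) (convexHull ℝ A) := by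
    rw [Set.disjoint_left]
    intro s hs hsA
    obtain ⟨v, hv⟩ := hcon s hsA
    exact absurd (hs v trivial) (not_lt.2 hv)
  obtain ⟨φ, u, h1, h2⟩ := geometric_hahn_banach_open hC hO (convex_convexHull ℝ A) hdis
  set c : V → ℝ := fun v => φ (Pi.single v 1) with hc
  have hφ : ∀ s, φ s = ∑ v, c v * s v := by
    intro s
    conv_lhs => rw [pi_eq_sum_univ' s]
    rw [map_sum]
    refine Finset.sum_congr rfl fun v _ => ?_
    rw [map_smul, smul_eq_mul, mul_comm]
  have hone : φ (fun _ => a) < u := h1 _ fun v _ => hab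
  have hc0 : ∀ v, 0 ≤ c v := by
    intro v
    by_contra hv
    push Not at hv
    have key : ∀ k : ℝ, 0 ≤ k → φ (fun _ => a) - k * c v < u := by
      intro k hk
      have := h1 ((fun _ => a) - k • Pi.single v 1) (by
        intro i _
        by_cases hi : i = v
        · subst hi
          simp
          linarith
        · simp [hi]
          exact hab)
      rwa [map_sub, map_smul, smul_eq_mul] at this
    have := key ((u - φ (fun _ => a)) / (- c v)) (div_nonneg (by linarith) (by linarith))
    have h3 : (u - φ (fun _ => a)) / (- c v) * c v = - (u - φ (fun _ => a)) := by
      have := hv.ne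
      field_simp
    rw [h3] at this
    linarith
  have hAne : A.Nonempty := by
    obtain ⟨s, hs, -⟩ := h (fun _ => (Fintype.card V : ℝ)⁻¹) (fun _ => by positivity) (by simp)
    exact ⟨s, hs⟩
  have hcs : 0 < ∑ v, c v := by
    refine lt_of_le_of_ne (Finset.sum_nonneg fun v _ => hc0 v) fun h0 => ?_
    have hz := (Finset.sum_eq_zero_iff_of_nonneg fun v _ => hc0 v).1 h0.symm
    obtain ⟨s, hs⟩ := hAne
    have h3 := h2 s (subset_convexHull ℝ A hs)
    rw [hφ, Finset.sum_eq_zero fun v hv => by rw [hz v hv, zero_mul]] at h3 hone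
    linarith
  obtain ⟨s, hs, hle⟩ := h (fun v => c v / ∑ v, c v) (fun v => div_nonneg (hc0 v) hcs.le)
    (by rw [← Finset.sum_div, div_self hcs.ne'])
  have h3 := h2 s (subset_convexHull ℝ A hs)
  have h4 : ∑ v, c v / (∑ v, c v) * s v = (∑ v, c v * s v) / ∑ v, c v := by
    rw [Finset.sum_div]
    exact Finset.sum_congr rfl fun v _ => by ring
  rw [h4, div_le_iff₀ hcs] at hle
  rw [hφ] at h3 hone
  rw [← Finset.sum_mul] at hone
  linarith

/-- a finitely supported distribution over spanning clan embeddings into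
trees, each with multiplicative distortion `≤ C·log₂(n)·(1 + log₂ log₂ n)/ε`, with expected
clan size of every vertex at most `1 + ε`. -/
theorem spanning_clan_embedding_distribution_eps :
    ∃ C : ℝ, 0 < C ∧
      ∀ (V : Type) [Fintype V], ∀ (G : SimpleGraph V) (wG : Sym2 V → ℝ),
        2 ≤ Fintype.card V → G.Connected → (∀ e ∈ G.edgeSet, 0 < wG e) →
        ∀ ε : ℝ, 0 < ε → ε ≤ 1 →
        ∃ (m : ℕ) (p : Fin m → ℝ)
          (Y : Fin m → Type) (_ : ∀ i, Fintype (Y i))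
          (T : ∀ i, SimpleGraph (Y i)) (wT : ∀ i, Sym2 (Y i) → ℝ)
          (f : ∀ i, V → Finset (Y i)) (χ : ∀ i, V → Y i),
          (∀ i, 0 ≤ p i) ∧ (∑ i, p i = 1) ∧
          (∀ i, IsSpanningClanTree G wG (T i) (wT i) (f i) (χ i)
              (C * Real.logb 2 (Fintype.card V) *
                (1 + Real.logb 2 (Real.logb 2 (Fintype.card V))) / ε)) ∧
          ∀ v : V, ∑ i, p i * ((f i v).card : ℝ) ≤ 1 + ε := by
  refine ⟨8192, by norm_num, ?_⟩
  intro V _ G wG hn hG hw ε hε hε1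
  have : Nonempty V := hG.nonempty
  obtain ⟨s, hs, hlt⟩ := minimax _ (a := 1 + ε / 2) (b := 1 + ε) (by linarith) (by linarith)
    (fun lam h0 h1 => weighted_exists hn hG hw hε hε1 lam h0 h1)
  obtain ⟨ι, hι, p, z, hp, hp1, hz, rfl⟩ := mem_convexHull_iff_exists_fintype.1 hs
  choose Y hY T wT f χ hT hf using hz
  let e := (Fintype.equivFin ι).symm
  refine ⟨Fintype.card ι, fun i => p (e i), fun i => Y (e i), fun i => hY (e i), fun i => T (e i),
    fun i => wT (e i), fun i => f (e i), fun i => χ (e i), fun i => hp _, ?_, fun i => hT _, ?_⟩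
  · rw [← hp1]
    exact Equiv.sum_comp e p
  · intro v
    refine le_trans (le_of_eq ?_) (hlt v).le
    rw [Equiv.sum_comp e (fun i => p i * ((f i v).card : ℝ)), Finset.sum_apply]
    refine Finset.sum_congr rfl fun i _ => ?_
    rw [Pi.smul_apply, smul_eq_mul, hf]
end

section
/- There is a universal constant C > 0 such that for every weighted graph G = (V, E, w) on n ≥ 2 vertices and every integer k ≥ 1 there exist m ∈ ℕ, nonnegative reals p_1,…,p_m summing to 1, and spanning clan embeddings (f_1,χ_1),…,(f_m,χ_m) of G into trees, each with multiplicative distortion at most C·k·(1 + log₂ log₂ n), such that for every vertex v ∈ V one has Σ_{i=1}^m p_i·|f_i(v)| ≤ C·n^{1/k}. -/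
namespace SCE

set_option linter.unusedSectionVars false
set_option linter.unusedVariables false

/-- total weight of a walk -/
noncomputable def wt {V : Type*} {G : SimpleGraph V} (w : Sym2 V → ℝ) {u v : V} (p : G.Walk u v) : ℝ :=
  (p.edges.map w).sum

section basic
variable {V : Type*} {G : SimpleGraph V} {w : Sym2 V → ℝ}

@[simp] lemma wt_nil (u : V) : wt w (SimpleGraph.Walk.nil : G.Walk u u) = 0 := by simp [wt]

@[simp] lemma wt_cons {u v x : V} (h : G.Adj u v) (p : G.Walk v x) :
    wt w (SimpleGraph.Walk.cons h p) = w s(u, v) + wt w p := by simp [wt]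

lemma wt_append {u v x : V} (p : G.Walk u v) (q : G.Walk v x) :
    wt w (p.append q) = wt w p + wt w q := by simp [wt]

lemma wt_reverse {u v : V} (p : G.Walk u v) : wt w p.reverse = wt w p := by
  simp [wt, List.sum_reverse]

lemma wt_nonneg (hw : ∀ e ∈ G.edgeSet, 0 < w e) {u v : V} (p : G.Walk u v) : 0 ≤ wt w p := by
  apply List.sum_nonneg
  intro x hx
  obtain ⟨e, he, rfl⟩ := List.mem_map.1 hx
  exact (hw e (p.edges_subset_edgeSet he)).le

lemma wt_mono {w' : Sym2 V → ℝ} (h : ∀ e ∈ G.edgeSet, w e ≤ w' e) {u v : V} (p : G.Walk u v) :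
    wt w p ≤ wt w' p := by
  apply List.sum_le_sum
  intro e he
  exact h e (p.edges_subset_edgeSet he)

lemma wt_smul (c : ℝ) {u v : V} (p : G.Walk u v) :
    wt (fun e => c * w e) p = c * wt w p := by
  simp [wt, List.sum_map_mul_left]

lemma spDist_bdd (hw : ∀ e ∈ G.edgeSet, 0 < w e) (u v : V) :
    BddBelow (Set.range fun p : G.Walk u v => (p.edges.map w).sum) :=
  ⟨0, by rintro _ ⟨p, rfl⟩; exact wt_nonneg hw p⟩

lemma spDist_le_wt (hw : ∀ e ∈ G.edgeSet, 0 < w e) {u v : V} (p : G.Walk u v) :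
    spDist G w u v ≤ wt w p := csInf_le (spDist_bdd hw u v) ⟨p, rfl⟩

lemma le_spDist {u v : V} (hr : G.Reachable u v) {c : ℝ} (h : ∀ p : G.Walk u v, c ≤ wt w p) :
    c ≤ spDist G w u v := by
  obtain ⟨p⟩ := hr
  refine le_csInf ⟨_, ⟨p, rfl⟩⟩ ?_
  rintro _ ⟨q, rfl⟩
  exact h q

lemma spDist_nonneg (hw : ∀ e ∈ G.edgeSet, 0 < w e) (u v : V) : 0 ≤ spDist G w u v := by
  apply Real.sInf_nonneg
  rintro _ ⟨q, rfl⟩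
  exact wt_nonneg hw q

lemma spDist_self (hw : ∀ e ∈ G.edgeSet, 0 < w e) (u : V) : spDist G w u u = 0 := by
  apply le_antisymm _ (spDist_nonneg hw u u)
  simpa using spDist_le_wt hw (SimpleGraph.Walk.nil : G.Walk u u)

lemma wt_bypass [DecidableEq V] (hw : ∀ e ∈ G.edgeSet, 0 < w e) {u v : V} (p : G.Walk u v) :
    wt w p.bypass ≤ wt w p := by
  apply List.Sublist.sum_le_sum (p.edges_bypass_sublist_edges.map w)
  intro x hx
  obtain ⟨e, he, rfl⟩ := List.mem_map.1 hx
  exact (hw e (p.edges_subset_edgeSet he)).le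

lemma exists_min_walk [Finite V] (hw : ∀ e ∈ G.edgeSet, 0 < w e) {u v : V} (hr : G.Reachable u v) :
    ∃ p : G.Walk u v, wt w p = spDist G w u v := by
  classical
  have := Fintype.ofFinite V
  obtain ⟨p0⟩ := hr
  have hfin : Set.Finite {p : G.Walk u v | p.length < Fintype.card V} := Set.toFinite _
  have hne : Set.Nonempty {p : G.Walk u v | p.length < Fintype.card V} :=
    ⟨p0.bypass, p0.bypass_isPath.length_lt⟩
  obtain ⟨p, hp, hmin⟩ := Set.exists_min_image _ (fun p => wt w p) hfin hne
  refine ⟨p, le_antisymm ?_ (spDist_le_wt hw p)⟩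
  apply le_spDist ⟨p⟩
  intro q
  exact (hmin q.bypass q.bypass_isPath.length_lt).trans (wt_bypass hw q)

lemma spDist_comm (u v : V) : spDist G w u v = spDist G w v u := by
  unfold spDist
  congr 1
  ext x
  constructor
  · rintro ⟨p, rfl⟩; exact ⟨p.reverse, wt_reverse p⟩
  · rintro ⟨p, rfl⟩; exact ⟨p.reverse, wt_reverse p⟩

lemma spDist_triangle [Finite V] (hw : ∀ e ∈ G.edgeSet, 0 < w e) {u v x : V}
    (h1 : G.Reachable u v) (h2 : G.Reachable v x) :
    spDist G w u x ≤ spDist G w u v + spDist G w v x := by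
  obtain ⟨p, hp⟩ := exists_min_walk hw h1
  obtain ⟨q, hq⟩ := exists_min_walk hw h2
  rw [← hp, ← hq, ← wt_append]
  exact spDist_le_wt hw _

lemma spDist_adj (hw : ∀ e ∈ G.edgeSet, 0 < w e) {u v : V} (h : G.Adj u v) :
    spDist G w u v ≤ w s(u, v) := by
  simpa using spDist_le_wt hw (SimpleGraph.Walk.cons h SimpleGraph.Walk.nil)

lemma spDist_pos [Finite V] (hw : ∀ e ∈ G.edgeSet, 0 < w e) {u v : V} (hr : G.Reachable u v)
    (hne : u ≠ v) : 0 < spDist G w u v := by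
  obtain ⟨p, hp⟩ := exists_min_walk hw hr
  rw [← hp]
  cases p with
  | nil => exact absurd rfl hne
  | cons h p =>
    rw [wt_cons]
    have := wt_nonneg hw p
    have := hw s(_, _) h
    linarith

/-- distances shrink along weight-preserving homs -/
lemma spDist_hom {V' : Type*} {G' : SimpleGraph V'} {w' : Sym2 V' → ℝ}
    (hw' : ∀ e ∈ G'.edgeSet, 0 < w' e) (φ : G →g G')
    (hφ : ∀ e ∈ G.edgeSet, w' (e.map φ) = w e) {u v : V} (hr : G.Reachable u v) :
    spDist G' w' (φ u) (φ v) ≤ spDist G w u v := by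
  apply le_spDist hr
  intro p
  have : wt w' (p.map φ) = wt w p := by
    unfold wt
    rw [SimpleGraph.Walk.edges_map, List.map_map]
    congr 1
    apply List.map_congr_left
    intro e he
    exact hφ e (p.edges_subset_edgeSet he)
  rw [← this]
  exact spDist_le_wt hw' _

/-- vertices of a geodesic -/
lemma min_walk_split [DecidableEq V] {u v x : V} (p : G.Walk u v) (hx : x ∈ p.support) :
    wt w (p.takeUntil x hx) + wt w (p.dropUntil x hx) = wt w p := by
  rw [← wt_append, p.take_spec]

lemma geod_seq {h : V → ℝ} (hlip : ∀ a b, G.Adj a b → h b ≤ h a + w s(a, b)) {a v : V}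
    (p : G.Walk a v) (hp : h a + wt w p = h v) :
    ∃ (q : ℕ → V) (L : ℕ), q 0 = a ∧ q L = v ∧
      ∀ i < L, G.Adj (q i) (q (i + 1)) ∧ h (q (i + 1)) = h (q i) + w s(q i, q (i + 1)) := by
  have lip : ∀ {a b : V} (p : G.Walk a b), h b ≤ h a + wt w p := by
    intro a b p
    induction p with
    | nil => simp
    | cons hab p ih =>
      have := hlip _ _ hab
      rw [wt_cons]; linarith
  induction p with
  | nil => exact ⟨fun _ => _, 0, rfl, rfl, by simp⟩
  | @cons a b c hab p ih =>
    rw [wt_cons] at hp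
    have h1 := lip p
    have h2 := hlip _ _ hab
    obtain ⟨q, L, hq0, hqL, hq⟩ := ih (by linarith)
    refine ⟨fun i => if i = 0 then a else q (i - 1), L + 1, by simp, by simp [hqL], ?_⟩
    intro i hi
    rcases i with _ | i
    · simp only [if_true, zero_add, Nat.sub_self, hq0, one_ne_zero, if_false]
      exact ⟨hab, by linarith⟩
    · simpa using hq i (by omega)

end basic

/-- gluing two trees by an edge -/
lemma glue_tree {Y₁ Y₂ : Type} [Fintype Y₁] [Fintype Y₂] {T₁ : SimpleGraph Y₁} {T₂ : SimpleGraph Y₂}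
    (h₁ : T₁.IsTree) (h₂ : T₂.IsTree) (a : Y₁) (b : Y₂) :
    (T₁.sum T₂ ⊔ SimpleGraph.edge (.inl a) (.inr b)).IsTree := by
  classical
  rw [SimpleGraph.isTree_iff_connected_and_card]
  refine ⟨h₁.connected.sum_sup_edge h₂.connected, ?_⟩
  have e1 := (SimpleGraph.isTree_iff_connected_and_card.1 h₁).2
  have e2 := (SimpleGraph.isTree_iff_connected_and_card.1 h₂).2
  have e3 := Nat.card_congr (SimpleGraph.edgeSetSumEquiv (G := T₁) (H := T₂))
  rw [Nat.card_sum] at e3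
  have e4 := SimpleGraph.card_edgeFinset_sup_edge (T₁.sum T₂) (s := .inl a) (t := .inr b)
    (SimpleGraph.not_adj_sum_inl_inr a b) (by simp)
  rw [Nat.card_eq_fintype_card, ← SimpleGraph.edgeFinset_card, e4, Nat.card_sum,
    SimpleGraph.edgeFinset_card, ← Nat.card_eq_fintype_card]
  omega


lemma seq1 (e : ℝ) (he : 0 < e) (N : ℕ) (hN1 : 1 ≤ N) (m : ℝ) (a : ℕ → ℝ)
    (ha : ∀ i ≤ N, 1 ≤ a i) (hN : a N ≤ m / 2)
    (hm : Real.log m ≤ (1 + e) ^ N * Real.log 2) :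
    ∃ i < N, a (i + 1) ^ (1 + e) ≤ a i * m ^ e := by
  by_contra hcon
  push Not at hcon
  have hmpos : 0 < m := by have := ha N le_rfl; linarith
  have key : ∀ i < N, (1 + e) * (Real.log m - Real.log (a (i + 1))) < Real.log m - Real.log (a i) := by
    intro i hi
    have h0 : 0 < a i := by have := ha i hi.le; linarith
    have h1 : 0 < a (i + 1) := by have := ha (i + 1) hi; linarith
    have h2 : 0 < m ^ e := Real.rpow_pos_of_pos hmpos _
    have := Real.log_lt_log (mul_pos h0 h2) (hcon i hi)
    rw [Real.log_mul h0.ne' h2.ne', Real.log_rpow hmpos, Real.log_rpow h1] at this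
    nlinarith
  have ind : ∀ j < N, (1 + e) ^ (j + 1) * (Real.log m - Real.log (a (j + 1)))
      < Real.log m - Real.log (a 0) := by
    intro j
    induction j with
    | zero => intro hj; simpa using key 0 hj
    | succ j ih =>
      intro hj
      refine lt_trans ?_ (ih (by omega))
      rw [pow_succ (1 + e) (j + 1), mul_assoc]
      exact mul_lt_mul_of_pos_left (key (j + 1) hj) (by positivity)
  obtain ⟨M, rfl⟩ : ∃ M, N = M + 1 := ⟨N - 1, by omega⟩
  have h1 := ind M (by omega)
  have h2 : 0 ≤ Real.log (a 0) := Real.log_nonneg (ha 0 (by omega))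
  have h3 : Real.log 2 ≤ Real.log m - Real.log (a (M + 1)) := by
    have hp : 0 < a (M + 1) := by have := ha (M + 1) le_rfl; linarith
    rw [← Real.log_div hmpos.ne' hp.ne']
    apply Real.log_le_log (by norm_num)
    rw [le_div_iff₀ hp]; linarith
  have h4 : (1 + e) ^ (M + 1) * Real.log 2 ≤
      (1 + e) ^ (M + 1) * (Real.log m - Real.log (a (M + 1))) :=
    mul_le_mul_of_nonneg_left h3 (by positivity)
  linarith

lemma seq2 (e : ℝ) (he : 0 < e) (N : ℕ) (hN1 : 1 ≤ N) (m : ℝ) (a : ℕ → ℝ)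
    (ha : ∀ i ≤ 2 * N, 1 ≤ a i) (ha' : ∀ i ≤ 2 * N, a i ≤ m - 1)
    (hm : Real.log m ≤ (1 + e) ^ N * Real.log 2) :
    ∃ j < 2 * N, a (j + 1) ^ (1 + e) + (m - a j) ^ (1 + e) ≤ m ^ (1 + e) := by
  have hmpos : 0 < m := by have := ha 0 (by omega); have := ha' 0 (by omega); linarith
  have aux : ∀ x : ℝ, 0 < x → x ≤ m → x ^ (1 + e) ≤ x * m ^ e := by
    intro x hx hxm
    rw [Real.rpow_add hx, Real.rpow_one]
    exact mul_le_mul_of_nonneg_left (Real.rpow_le_rpow hx.le hxm he.le) hx.le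
  have hme : m ^ (1 + e) = m * m ^ e := by rw [Real.rpow_add hmpos, Real.rpow_one]
  rcases le_total (a N) (m / 2) with h | h
  · obtain ⟨i, hi, hle⟩ := seq1 e he N hN1 m a (fun i hi => ha i (by omega)) h hm
    refine ⟨i, by omega, ?_⟩
    have := aux (m - a i) (by have := ha' i (by omega); linarith)
      (by have := ha i (by omega); linarith)
    rw [hme]; nlinarith
  · obtain ⟨i, hi, hle⟩ := seq1 e he N hN1 m (fun i => m - a (2 * N - i))
      (fun i hi => by have := ha' (2 * N - i) (by omega); show (1:ℝ) ≤ m - a (2 * N - i); linarith)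
      (by rw [show 2 * N - N = N by omega]; linarith) hm
    refine ⟨2 * N - (i + 1), by omega, ?_⟩
    rw [show 2 * N - (i + 1) + 1 = 2 * N - i by omega]
    have := aux (a (2 * N - i)) (by have := ha (2 * N - i) (by omega); linarith)
      (by have := ha' (2 * N - i) (by omega); linarith)
    rw [hme]; nlinarith

lemma choose_N (n k : ℕ) (hn : 2 ≤ n) (hk : 1 ≤ k) :
    ∃ N : ℕ, 1 ≤ N ∧ Real.log (2 * n) ≤ (1 + 1 / (k : ℝ)) ^ N * Real.log 2 ∧
      (N : ℝ) ≤ 2 * k * (1 + Real.logb 2 (Real.logb 2 n)) := by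
  have hn' : (2 : ℝ) ≤ n := by exact_mod_cast hn
  have hk' : (1 : ℝ) ≤ k := by exact_mod_cast hk
  set l := Real.logb 2 n with hl
  have hl1 : 1 ≤ l := by
    rw [hl, Real.le_logb_iff_rpow_le (by norm_num) (by linarith)]; simpa using hn'
  have hll : 0 ≤ Real.logb 2 l := Real.logb_nonneg (by norm_num) hl1
  set c := ⌈Real.logb 2 (1 + l)⌉₊ with hc
  have hb1 : 1 ≤ Real.logb 2 (1 + l) := by
    rw [Real.le_logb_iff_rpow_le (by norm_num) (by linarith)]; norm_num; linarith
  have hc1 : 1 ≤ c := Nat.one_le_ceil_iff.2 (by linarith)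
  refine ⟨k * c, Nat.mul_pos hk hc1, ?_, ?_⟩
  · have h1 : (2 : ℝ) ≤ (1 + 1 / (k : ℝ)) ^ k := by
      have := one_add_mul_le_pow (a := 1 / (k : ℝ)) (by have : 0 < 1 / (k:ℝ) := by positivity
                                                        linarith) k
      rw [mul_one_div_cancel (by linarith)] at this
      linarith
    have h2 : 1 + l ≤ (2 : ℝ) ^ c := by
      have := Nat.le_ceil (Real.logb 2 (1 + l))
      rw [← hc, Real.logb_le_iff_le_rpow (by norm_num) (by linarith)] at this
      exact_mod_cast this
    have h3 : (2 : ℝ) ^ c ≤ (1 + 1 / (k : ℝ)) ^ (k * c) := by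
      rw [pow_mul]; exact pow_le_pow_left₀ (by norm_num) h1 c
    have hlog2 : 0 < Real.log 2 := Real.log_pos (by norm_num)
    have h4 : Real.log (2 * n) = (1 + l) * Real.log 2 := by
      rw [Real.log_mul (by norm_num) (by linarith), hl, Real.logb]
      field_simp
    rw [h4]
    exact mul_le_mul_of_nonneg_right (h2.trans h3) hlog2.le
  · have h1 : (c : ℝ) ≤ Real.logb 2 (1 + l) + 1 := (Nat.ceil_lt_add_one (by linarith)).le
    have h2 : Real.logb 2 (1 + l) ≤ 1 + Real.logb 2 l := by
      have : Real.logb 2 (2 * l) = 1 + Real.logb 2 l := by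
        rw [Real.logb_mul (by norm_num) (by linarith), Real.logb_self_eq_one (by norm_num)]
      rw [← this]
      exact Real.logb_le_logb_of_le (by norm_num) (by linarith) (by linarith)
    push_cast
    nlinarith

lemma minimax {V : Type} [Fintype V] [Nonempty V] (S : Set (V → ℝ)) (c c' : ℝ) (hcc : c < c')
    (hS : ∀ g : V → ℝ, (∀ v, 0 ≤ g v) → 0 < ∑ v, g v → ∃ s ∈ S, ∑ v, g v * s v ≤ c * ∑ v, g v) :
    ∃ x ∈ convexHull ℝ S, ∀ v, x v < c' := by
  classical
  by_contra hcon
  push Not at hcon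
  let O : Set (V → ℝ) := {x | ∀ v, x v < c'}
  have hO : O = Set.pi Set.univ (fun _ => Set.Iio c') := by ext x; simp [O]
  have hO1 : Convex ℝ O := by rw [hO]; exact convex_pi (fun _ _ => convex_Iio c')
  have hO2 : IsOpen O := by rw [hO]; exact isOpen_set_pi Set.finite_univ (fun _ _ => isOpen_Iio)
  have hdis : Disjoint O (convexHull ℝ S) := by
    rw [Set.disjoint_left]
    intro x hx hx'
    obtain ⟨v, hv⟩ := hcon x hx'
    exact absurd (hx v) (not_lt.2 hv)
  obtain ⟨f, u, hfO, hfS⟩ := geometric_hahn_banach_open hO1 hO2 (convex_convexHull ℝ S) hdis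
  let g : V → ℝ := fun v => f (Pi.single v 1)
  have hf : ∀ x : V → ℝ, f x = ∑ v, g v * x v := by
    intro x
    conv_lhs => rw [pi_eq_sum_univ' x]
    rw [map_sum]
    apply Finset.sum_congr rfl
    intro v _
    rw [map_smul, smul_eq_mul, mul_comm]
  have hg : ∀ v, 0 ≤ g v := by
    intro v
    by_contra hneg
    push Not at hneg
    have hmem : ∀ s : ℝ, 0 ≤ s → (fun j => c' - 1 - if j = v then s else 0) ∈ O := by
      intro s hs j
      simp only
      split_ifs <;> linarith
    have hval : ∀ s : ℝ, f (fun j => c' - 1 - if j = v then s else 0) = (c' - 1) * ∑ j, g j - g v * s := by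
      intro s
      rw [hf]
      simp only [mul_sub, Finset.sum_sub_distrib, mul_ite, mul_zero, Finset.sum_ite_eq', Finset.mem_univ, if_true]
      rw [← Finset.sum_mul, ← Finset.sum_mul]; ring
    set A := (c' - 1) * ∑ j, g j with hA
    have h0 := hfO _ (hmem ((|u| + |A|) / (- g v)) (by apply div_nonneg (by positivity); linarith))
    rw [hval] at h0
    have h1 : g v * ((|u| + |A|) / (- g v)) = - (|u| + |A|) := by
      have := hneg.ne
      rw [div_neg, mul_neg, mul_div_cancel₀ _ this]
    rw [h1] at h0
    have := le_abs_self u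
    have := neg_abs_le A
    linarith
  have hlim : c' * ∑ v, g v ≤ u := by
    apply le_of_forall_pos_le_add
    intro ε hε
    have hG : 0 ≤ ∑ v, g v := Finset.sum_nonneg (fun v _ => hg v)
    have h0 := hfO (fun _ => c' - ε / (∑ v, g v + 1)) (by intro v; simp only; have : 0 < ε / (∑ v, g v + 1) := by positivity
                                                          linarith)
    rw [hf, ← Finset.sum_mul] at h0
    have h1 : (∑ v, g v) * (ε / (∑ v, g v + 1)) ≤ ε := by
      rw [← mul_div_assoc, div_le_iff₀ (by positivity)]
      nlinarith
    nlinarith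
  have hpos : 0 < ∑ v, g v := by
    by_contra hle
    have hz : ∑ v, g v = 0 := le_antisymm (not_lt.1 hle) (Finset.sum_nonneg (fun v _ => hg v))
    have hz' : ∀ v, g v = 0 := fun v =>
      (Finset.sum_eq_zero_iff_of_nonneg (fun v _ => hg v)).1 hz v (Finset.mem_univ v)
    have h0 := hfO (fun _ => c' - 1) (by intro v; simp only; linarith)
    obtain ⟨s, hs, _⟩ := hS (fun _ => 1) (by simp) (by simp [Fintype.card_pos])
    have h1 := hfS s (subset_convexHull ℝ S hs)
    rw [hf] at h0 h1
    simp [hz'] at h0 h1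
    linarith
  obtain ⟨s, hs, hle⟩ := hS g hg hpos
  have h1 := hfS s (subset_convexHull ℝ S hs)
  rw [hf] at h1
  nlinarith

/-- `G` restricted to edges inside `X`. -/
def HH {V : Type} (G : SimpleGraph V) (X : Finset V) : SimpleGraph V where
  Adj u v := G.Adj u v ∧ u ∈ X ∧ v ∈ X
  symm := ⟨fun _ _ h => ⟨h.1.symm, h.2.2, h.2.1⟩⟩
  loopless := ⟨fun _ h => h.1.ne rfl⟩

section cluster
variable {V : Type} [Fintype V] [DecidableEq V] {G : SimpleGraph V} {X : Finset V}

lemma HH_le : HH G X ≤ G := fun _ _ h => h.1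

lemma HH_mono {X' : Finset V} (h : X' ⊆ X) : HH G X' ≤ HH G X :=
  fun _ _ h' => ⟨h'.1, h h'.2.1, h h'.2.2⟩

lemma HH_pos {w : Sym2 V → ℝ} (hw : ∀ e ∈ G.edgeSet, 0 < w e) (X : Finset V) :
    ∀ e ∈ (HH G X).edgeSet, 0 < w e :=
  fun e he => hw e (SimpleGraph.edgeSet_mono HH_le he)

lemma walk_restrict {X' : Finset V} {u v : V} (p : (HH G X).Walk u v)
    (hs : ∀ z ∈ p.support, z ∈ X') :
    ∃ p' : (HH G X').Walk u v, ∀ w : Sym2 V → ℝ, wt w p' = wt w p := by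
  have h : ∀ e ∈ p.edges, e ∈ (HH G X').edgeSet := by
    intro e he
    induction e with
    | _ a b =>
      have h1 := p.adj_of_mem_edges he
      exact ⟨h1.1, hs _ (p.fst_mem_support_of_mem_edges he), hs _ (p.snd_mem_support_of_mem_edges he)⟩
  refine ⟨p.transfer _ h, fun w => ?_⟩
  simp [wt, SimpleGraph.Walk.edges_transfer]

lemma support_mem {u v : V} (p : (HH G X).Walk u v) (hu : u ∈ X) : ∀ z ∈ p.support, z ∈ X := by
  induction p with
  | nil => simpa using hu
  | cons h p ih =>
    intro z hz
    rw [SimpleGraph.Walk.support_cons, List.mem_cons] at hz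
    rcases hz with rfl | hz
    · exact hu
    · exact ih h.2.2 z hz

lemma spDist_anti {w : Sym2 V → ℝ} (hw : ∀ e ∈ G.edgeSet, 0 < w e) {X' : Finset V} (h : X' ⊆ X)
    {u v : V} (hr : (HH G X').Reachable u v) :
    spDist (HH G X) w u v ≤ spDist (HH G X') w u v := by
  apply le_spDist hr
  intro p
  have := spDist_le_wt (HH_pos hw X) (p.mapLe (HH_mono h))
  simpa [wt] using this

/-- the petal of radius `r` -/
noncomputable def petal (G : SimpleGraph V) (X : Finset V) (w : Sym2 V → ℝ) (o : V) (q : ℕ → V)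
    (L : ℕ) (r : ℝ) : Finset V :=
  open Classical in
  X.filter (fun z => ∃ j ≤ L, spDist (HH G X) w (q j) z + spDist (HH G X) w o (q j)
    - spDist (HH G X) w o z ≤ (r - (spDist (HH G X) w o (q L) - spDist (HH G X) w o (q j))) / 2)

/-- geodesic sequence from the root -/
structure Geo (G : SimpleGraph V) (X : Finset V) (w : Sym2 V → ℝ) (o : V) (q : ℕ → V)
    (L : ℕ) : Prop where
  pos : ∀ e ∈ G.edgeSet, 0 < w e
  reach : ∀ z ∈ X, (HH G X).Reachable o z
  zero : q 0 = o
  mem : ∀ i ≤ L, q i ∈ X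
  step : ∀ i < L, G.Adj (q i) (q (i + 1)) ∧
    spDist (HH G X) w o (q (i + 1)) = spDist (HH G X) w o (q i) + w s(q i, q (i + 1))

namespace Geo
variable {w : Sym2 V → ℝ} {o : V} {q : ℕ → V} {L : ℕ} {r : ℝ}

lemma omem (g : Geo G X w o q L) : o ∈ X := g.zero ▸ g.mem 0 (Nat.zero_le _)

lemma rr (g : Geo G X w o q L) {a b : V} (ha : a ∈ X) (hb : b ∈ X) : (HH G X).Reachable a b :=
  (g.reach a ha).symm.trans (g.reach b hb)

lemma tri (g : Geo G X w o q L) {a b c : V} (ha : a ∈ X) (hb : b ∈ X) (hc : c ∈ X) :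
    spDist (HH G X) w a c ≤ spDist (HH G X) w a b + spDist (HH G X) w b c :=
  spDist_triangle (HH_pos g.pos X) (g.rr ha hb) (g.rr hb hc)

lemma nn (g : Geo G X w o q L) (a b : V) : 0 ≤ spDist (HH G X) w a b :=
  spDist_nonneg (HH_pos g.pos X) a b

lemma mono_h (g : Geo G X w o q L) {i j : ℕ} (hij : i ≤ j) (hj : j ≤ L) :
    spDist (HH G X) w o (q i) ≤ spDist (HH G X) w o (q j) := by
  induction j, hij using Nat.le_induction with
  | base => exact le_rfl
  | succ j hij ih =>
    have h1 := g.step j (by omega)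
    have h2 := g.pos s(q j, q (j + 1)) h1.1
    have := ih (by omega)
    linarith [h1.2]

lemma petal_sub (g : Geo G X w o q L) : petal G X w o q L r ⊆ X := Finset.filter_subset _ _

lemma mem_petal {z : V} : z ∈ petal G X w o q L r ↔ z ∈ X ∧ ∃ j ≤ L,
    spDist (HH G X) w (q j) z + spDist (HH G X) w o (q j)
    - spDist (HH G X) w o z ≤ (r - (spDist (HH G X) w o (q L) - spDist (HH G X) w o (q j))) / 2 := by
  classical
  unfold petal
  rw [Finset.mem_filter]

lemma petal_mono {r' : ℝ} (h : r ≤ r') : petal G X w o q L r ⊆ petal G X w o q L r' := by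
  intro z hz
  rw [mem_petal] at hz ⊢
  obtain ⟨h1, j, hj, h2⟩ := hz
  exact ⟨h1, j, hj, by linarith⟩

lemma petal_h (g : Geo G X w o q L) {z : V} (hz : z ∈ petal G X w o q L r) :
    spDist (HH G X) w o (q L) - r ≤ spDist (HH G X) w o z := by
  rw [mem_petal] at hz
  obtain ⟨h1, j, hj, h2⟩ := hz
  have h3 := g.tri g.omem (g.mem j hj) h1
  have h4 := g.nn (q j) z
  linarith

lemma q_mem (g : Geo G X w o q L) {i : ℕ} (hi : i ≤ L) : q i ∈ petal G X w o q L r ↔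
    spDist (HH G X) w o (q L) - spDist (HH G X) w o (q i) ≤ r := by
  constructor
  · intro h; have := g.petal_h h; linarith
  · intro h
    rw [mem_petal]
    refine ⟨g.mem i hi, i, hi, ?_⟩
    rw [spDist_self (HH_pos g.pos X)]
    linarith

lemma pad (g : Geo G X w o q L) {z z' : V} (hz : z ∈ petal G X w o q L r) (hz' : z' ∈ X) {δ : ℝ}
    (hd : spDist (HH G X) w z z' ≤ δ) : z' ∈ petal G X w o q L (r + 4 * δ) := by
  rw [mem_petal] at hz ⊢
  obtain ⟨h1, j, hj, h2⟩ := hz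
  refine ⟨hz', j, hj, ?_⟩
  have h3 := g.tri (g.mem j hj) h1 hz'
  have h4 := g.tri g.omem hz' h1
  rw [spDist_comm z' z] at h4
  linarith

lemma compl_walk (g : Geo G X w o q L) {z : V} (hz : z ∈ X) (hz' : z ∉ petal G X w o q L r) :
    ∃ p : (HH G (X \ petal G X w o q L r)).Walk o z, wt w p = spDist (HH G X) w o z := by
  obtain ⟨p, hp⟩ := exists_min_walk (HH_pos g.pos X) (g.reach z hz)
  have hs := support_mem p g.omem
  obtain ⟨p', hp'⟩ := walk_restrict (X' := X \ petal G X w o q L r) p (by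
    intro y hy
    rw [Finset.mem_sdiff]
    refine ⟨hs y hy, fun hyp => hz' ?_⟩
    rw [mem_petal] at hyp ⊢
    obtain ⟨h1, j, hj, h2⟩ := hyp
    refine ⟨hz, j, hj, ?_⟩
    have e1 := min_walk_split (w := w) p hy
    have e2 := spDist_le_wt (HH_pos g.pos X) (p.takeUntil y hy)
    have e3 := spDist_le_wt (HH_pos g.pos X) (p.dropUntil y hy)
    have e4 := g.tri (g.mem j hj) h1 hz
    linarith)
  exact ⟨p', by rw [hp', hp]⟩

lemma compl_dist (g : Geo G X w o q L) {z : V} (hz : z ∈ X \ petal G X w o q L r) :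
    spDist (HH G (X \ petal G X w o q L r)) w o z = spDist (HH G X) w o z := by
  rw [Finset.mem_sdiff] at hz
  obtain ⟨p, hp⟩ := g.compl_walk hz.1 hz.2
  apply le_antisymm
  · rw [← hp]; exact spDist_le_wt (HH_pos g.pos _) p
  · exact spDist_anti g.pos Finset.sdiff_subset ⟨p⟩

lemma petal_walk (g : Geo G X w o q L) {z : V} (hz : z ∈ X) {j : ℕ} (hj : j ≤ L)
    (h2 : spDist (HH G X) w (q j) z + spDist (HH G X) w o (q j)
    - spDist (HH G X) w o z ≤ (r - (spDist (HH G X) w o (q L) - spDist (HH G X) w o (q j))) / 2) :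
    ∃ p : (HH G (petal G X w o q L r)).Walk (q j) z, wt w p = spDist (HH G X) w (q j) z := by
  obtain ⟨p, hp⟩ := exists_min_walk (HH_pos g.pos X) (g.rr (g.mem j hj) hz)
  have hs := support_mem p (g.mem j hj)
  obtain ⟨p', hp'⟩ := walk_restrict (X' := petal G X w o q L r) p (by
    intro y hy
    rw [mem_petal]
    refine ⟨hs y hy, j, hj, ?_⟩
    have e1 := min_walk_split (w := w) p hy
    have e2 := spDist_le_wt (HH_pos g.pos X) (p.takeUntil y hy)
    have e3 := spDist_le_wt (HH_pos g.pos X) (p.dropUntil y hy)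
    have e4 := g.tri g.omem (hs y hy) hz
    linarith)
  exact ⟨p', by rw [hp', hp]⟩

/-- walking along the geodesic inside a subset -/
lemma along (g : Geo G X w o q L) {X₁ : Finset V} {w₁ : Sym2 V → ℝ}
    (hw₁ : ∀ e ∈ G.edgeSet, 0 < w₁ e) {θ : ℝ} {i₁ : ℕ}
    (hmem : ∀ i, i₁ ≤ i → i ≤ L → q i ∈ X₁)
    (hθ : ∀ i, i₁ ≤ i → i < L → w₁ s(q i, q (i + 1)) = θ * w s(q i, q (i + 1)))
    {j : ℕ} (hj : i₁ ≤ j) (hjL : j ≤ L) :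
    (HH G X₁).Reachable (q i₁) (q j) ∧ spDist (HH G X₁) w₁ (q i₁) (q j) ≤
      θ * (spDist (HH G X) w o (q j) - spDist (HH G X) w o (q i₁)) := by
  induction j, hj using Nat.le_induction with
  | base => exact ⟨SimpleGraph.Reachable.refl _, by rw [spDist_self (HH_pos hw₁ X₁)]; simp⟩
  | succ j hj ih =>
    obtain ⟨h1, h2⟩ := ih (by omega)
    have h3 := g.step j (by omega)
    have hadj : (HH G X₁).Adj (q j) (q (j + 1)) :=
      ⟨h3.1, hmem j hj (by omega), hmem (j + 1) (by omega) hjL⟩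
    refine ⟨h1.trans hadj.reachable, ?_⟩
    have h4 := spDist_triangle (HH_pos hw₁ X₁) h1 hadj.reachable
    have h5 := spDist_adj (HH_pos hw₁ X₁) hadj
    rw [hθ j hj (by omega)] at h5
    have h6 := h3.2
    rw [h6]
    linarith

lemma petal_main (g : Geo G X w o q L) {w₁ : Sym2 V → ℝ}
    (hw₁ : ∀ e ∈ G.edgeSet, 0 < w₁ e) {θ : ℝ} (hθ0 : 0 < θ) {i₁ : ℕ} (hi₁ : i₁ ≤ L)
    (hle : spDist (HH G X) w o (q L) - spDist (HH G X) w o (q i₁) ≤ r)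
    (hmin : ∀ i < i₁, r < spDist (HH G X) w o (q L) - spDist (HH G X) w o (q i))
    (hlow : ∀ e ∈ (HH G (petal G X w o q L r)).edgeSet, θ * w e ≤ w₁ e)
    (hup : ∀ e ∈ (HH G (petal G X w o q L r)).edgeSet, w₁ e ≤ w e)
    (hθ : ∀ i, i₁ ≤ i → i < L → w₁ s(q i, q (i + 1)) = θ * w s(q i, q (i + 1))) :
    (∀ i, i₁ ≤ i → i ≤ L → q i ∈ petal G X w o q L r) ∧
    (∀ z ∈ petal G X w o q L r, (HH G (petal G X w o q L r)).Reachable (q i₁) z) ∧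
    (∀ i, i₁ ≤ i → i ≤ L → spDist (HH G (petal G X w o q L r)) w₁ (q i₁) (q i) =
      θ * (spDist (HH G X) w o (q i) - spDist (HH G X) w o (q i₁))) ∧
    (∀ z ∈ petal G X w o q L r, ∃ j, i₁ ≤ j ∧ j ≤ L ∧
      spDist (HH G X) w (q j) z + spDist (HH G X) w o (q j)
      - spDist (HH G X) w o z ≤ (r - (spDist (HH G X) w o (q L) - spDist (HH G X) w o (q j))) / 2 ∧
      spDist (HH G (petal G X w o q L r)) w₁ (q i₁) z ≤
        θ * (spDist (HH G X) w o (q j) - spDist (HH G X) w o (q i₁)) + spDist (HH G X) w (q j) z) := by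
  have hmem : ∀ i, i₁ ≤ i → i ≤ L → q i ∈ petal G X w o q L r := by
    intro i h1 h2
    rw [g.q_mem h2]
    have := g.mono_h h1 h2
    linarith
  have main : ∀ z ∈ petal G X w o q L r, ∃ j, i₁ ≤ j ∧ j ≤ L ∧
      spDist (HH G X) w (q j) z + spDist (HH G X) w o (q j)
      - spDist (HH G X) w o z ≤ (r - (spDist (HH G X) w o (q L) - spDist (HH G X) w o (q j))) / 2 ∧
      (HH G (petal G X w o q L r)).Reachable (q i₁) z ∧
      spDist (HH G (petal G X w o q L r)) w₁ (q i₁) z ≤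
        θ * (spDist (HH G X) w o (q j) - spDist (HH G X) w o (q i₁)) + spDist (HH G X) w (q j) z := by
    intro z hz
    obtain ⟨h1, j, hj, h2⟩ := mem_petal.1 hz
    have hij : i₁ ≤ j := by
      by_contra hlt
      have h3 := hmin j (by omega)
      have h4 := g.tri g.omem (g.mem j hj) h1
      linarith
    obtain ⟨p, hp⟩ := g.petal_walk h1 hj h2
    obtain ⟨ha, hb⟩ := g.along hw₁ hmem hθ hij hj
    refine ⟨j, hij, hj, h2, ha.trans ⟨p⟩, ?_⟩
    have h5 := spDist_triangle (HH_pos hw₁ _) ha ⟨p⟩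
    have h6 := spDist_le_wt (HH_pos hw₁ _) p
    have h7 := wt_mono hup p
    linarith
  refine ⟨hmem, fun z hz => ?_, fun i h1 h2 => ?_, fun z hz => ?_⟩
  · obtain ⟨j, _, _, _, h, _⟩ := main z hz; exact h
  · obtain ⟨ha, hb⟩ := g.along hw₁ hmem hθ h1 h2
    refine le_antisymm hb ?_
    apply le_spDist ha
    intro p
    have h3 := wt_mono hlow p
    rw [wt_smul] at h3
    refine le_trans ?_ h3
    apply mul_le_mul_of_nonneg_left _ hθ0.le
    have h4 := spDist_le_wt (HH_pos g.pos _) p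
    have h5 := spDist_anti g.pos (petal_sub g) ha
    have h6 := g.tri g.omem (g.mem i₁ hi₁) (g.mem i h2)
    linarith
  · obtain ⟨j, h1, h2, h3, _, h4⟩ := main z hz; exact ⟨j, h1, h2, h3, h4⟩

end Geo
end cluster

/-- output of the recursion on a cluster `X` with root `o`, root distances `h`, highway `P`. -/
def Out {V : Type} (G : SimpleGraph V) (w : Sym2 V → ℝ) (μ : V → ℝ) (ex t : ℝ) (X : Finset V)
    (o : V) (h : V → ℝ) (P : V → Prop) : Prop :=
  ∃ (Y : Type) (_ : Fintype Y) (T : SimpleGraph Y) (π : Y → V) (root : Y) (χ : V → Y),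
    T.IsTree ∧ (∀ a b, T.Adj a b → G.Adj (π a) (π b)) ∧ (∀ y, π y ∈ X) ∧
    (∀ v ∈ X, π (χ v) = v) ∧ π root = o ∧
    (∀ y, spDist T (fun e => w (e.map π)) root y ≤ 4 * h (π y)) ∧
    (∀ v, P v → ∃ y, π y = v ∧ spDist T (fun e => w (e.map π)) root y ≤ 2 * h v) ∧
    (∀ x ∈ X, ∀ z, ∀ p : (HH G X).Walk x z, ∃ y, π y = z ∧
      spDist T (fun e => w (e.map π)) y (χ x) ≤ t * wt w p) ∧
    ∑ y, μ (π y) ≤ (∑ v ∈ X, μ v) ^ ex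

lemma tree_pos {V Y : Type} {G : SimpleGraph V} {w : Sym2 V → ℝ} (hw : ∀ e ∈ G.edgeSet, 0 < w e)
    {T : SimpleGraph Y} {π : Y → V} (hπ : ∀ a b, T.Adj a b → G.Adj (π a) (π b)) :
    ∀ e ∈ T.edgeSet, 0 < w (e.map π) := by
  intro e he
  induction e with
  | _ a b => exact hw s(π a, π b) (hπ a b he)

lemma glue {V : Type} [Fintype V] [DecidableEq V] {G : SimpleGraph V} {w : Sym2 V → ℝ}
    (hw : ∀ e ∈ G.edgeSet, 0 < w e) {μ : V → ℝ} {ex t : ℝ} (ht : 0 ≤ t)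
    {X X₁ X₂ B : Finset V} {o o₁ y₁ : V} {h h₁ h₂ : V → ℝ} {P P₁ P₂ : V → Prop} {s δ : ℝ}
    (O₁ : Out G w μ ex t X₁ o₁ h₁ P₁) (O₂ : Out G w μ ex t X₂ o h₂ P₂)
    (hX₁ : X₁ ⊆ X) (hX₂ : X₂ ⊆ X) (hy₁ : y₁ ∈ X₂) (hadj : G.Adj y₁ o₁)
    (hs : (P₂ y₁ ∧ 2 * h₂ y₁ ≤ s) ∨ 4 * h₂ y₁ ≤ s)
    (hh₂ : ∀ z ∈ X₂, h₂ z ≤ h z)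
    (hh₁ : ∀ z ∈ X₁, s + w s(y₁, o₁) + 4 * h₁ z ≤ 4 * h z)
    (hP : ∀ v, P v → (P₂ v ∧ h₂ v ≤ h v) ∨ (P₁ v ∧ s + w s(y₁, o₁) + 2 * h₁ v ≤ 2 * h v))
    (hB₁ : ∀ x ∈ X, x ∈ B → ∀ z, ∀ p : (HH G X).Walk x z, wt w p ≤ δ → ∀ y ∈ p.support, y ∈ X₁)
    (hB₂ : ∀ x ∈ X, x ∉ B → ∀ z, ∀ p : (HH G X).Walk x z, wt w p ≤ δ → ∀ y ∈ p.support, y ∈ X₂)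
    (hδ : 0 ≤ δ) (hfar : ∀ x ∈ X, ∀ z ∈ X, 4 * h x + 4 * h z ≤ t * δ)
    (hm : (∑ v ∈ X₁, μ v) ^ ex + (∑ v ∈ X₂, μ v) ^ ex ≤ (∑ v ∈ X, μ v) ^ ex) :
    Out G w μ ex t X o h P := by
  obtain ⟨Y₁, i₁, T₁, π₁, r₁, χ₁, tr₁, hom₁, mem₁, chi₁, root₁, A₁, C₁, D₁, E₁⟩ := O₁
  obtain ⟨Y₂, i₂, T₂, π₂, r₂, χ₂, tr₂, hom₂, mem₂, chi₂, root₂, A₂, C₂, D₂, E₂⟩ := O₂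
  obtain ⟨c, hc, hcs⟩ : ∃ c, π₂ c = y₁ ∧ spDist T₂ (fun e => w (e.map π₂)) r₂ c ≤ s := by
    rcases hs with ⟨h1, h2⟩ | h2
    · obtain ⟨c, hc, hc'⟩ := C₂ _ h1
      exact ⟨c, hc, hc'.trans h2⟩
    · refine ⟨χ₂ y₁, chi₂ _ hy₁, (A₂ _).trans ?_⟩
      rw [chi₂ _ hy₁]; exact h2
  let T : SimpleGraph (Y₂ ⊕ Y₁) := T₂.sum T₁ ⊔ SimpleGraph.edge (.inl c) (.inr r₁)
  let π : Y₂ ⊕ Y₁ → V := Sum.elim π₂ π₁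
  have tr : T.IsTree := glue_tree tr₂ tr₁ c r₁
  have hom : ∀ a b, T.Adj a b → G.Adj (π a) (π b) := by
    rintro (a | a) (b | b) hab
    · have : T₂.Adj a b := by simpa [T, SimpleGraph.edge_adj] using hab
      exact hom₂ _ _ this
    · have : a = c ∧ b = r₁ := by simpa [T, SimpleGraph.edge_adj] using hab
      obtain ⟨rfl, rfl⟩ := this
      simp only [π, Sum.elim_inl, Sum.elim_inr]
      rw [hc, root₁]; exact hadj
    · have : b = c ∧ a = r₁ := by simpa [T, SimpleGraph.edge_adj, and_comm, eq_comm] using hab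
      obtain ⟨rfl, rfl⟩ := this
      simp only [π, Sum.elim_inl, Sum.elim_inr]
      rw [hc, root₁]; exact hadj.symm
    · have : T₁.Adj a b := by simpa [T, SimpleGraph.edge_adj] using hab
      exact hom₁ _ _ this
  have pos := tree_pos hw hom
  have d₂ : ∀ a b, spDist T (fun e => w (e.map π)) (.inl a) (.inl b) ≤
      spDist T₂ (fun e => w (e.map π₂)) a b := by
    intro a b
    let φ : T₂ →g T := (SimpleGraph.Hom.ofLE le_sup_left).comp SimpleGraph.Embedding.sumInl.toHom
    refine spDist_hom pos φ ?_ (tr₂.connected.preconnected a b)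
    intro e he
    simp only [Sym2.map_map]
    rfl
  have d₁ : ∀ a b, spDist T (fun e => w (e.map π)) (.inr a) (.inr b) ≤
      spDist T₁ (fun e => w (e.map π₁)) a b := by
    intro a b
    let φ : T₁ →g T := (SimpleGraph.Hom.ofLE le_sup_left).comp SimpleGraph.Embedding.sumInr.toHom
    refine spDist_hom pos φ ?_ (tr₁.connected.preconnected a b)
    intro e he
    simp only [Sym2.map_map]
    rfl
  have de : spDist T (fun e => w (e.map π)) (.inl c) (.inr r₁) ≤ w s(y₁, o₁) := by
    have hA : T.Adj (.inl c) (.inr r₁) := by simp [T, SimpleGraph.edge_adj]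
    have := spDist_adj pos hA
    simpa [π, hc, root₁] using this
  have tri : ∀ a b c, spDist T (fun e => w (e.map π)) a c ≤
      spDist T (fun e => w (e.map π)) a b + spDist T (fun e => w (e.map π)) b c := fun a b c =>
    spDist_triangle pos (tr.connected.preconnected _ _) (tr.connected.preconnected _ _)
  have dr : ∀ a, spDist T (fun e => w (e.map π)) (.inl r₂) (.inr a) ≤
      s + w s(y₁, o₁) + spDist T₁ (fun e => w (e.map π₁)) r₁ a := by
    intro a
    have e1 := tri (.inl r₂) (.inl c) (.inr a)
    have e2 := tri (.inl c) (.inr r₁) (.inr a)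
    have e3 := d₂ r₂ c
    have e4 := d₁ r₁ a
    linarith
  have A : ∀ y, spDist T (fun e => w (e.map π)) (.inl r₂) y ≤ 4 * h (π y) := by
    rintro (y | y)
    · have := hh₂ _ (mem₂ y)
      have := A₂ y
      have := d₂ r₂ y
      simp only [π, Sum.elim_inl]
      linarith
    · have := hh₁ _ (mem₁ y)
      have := A₁ y
      have := dr y
      simp only [π, Sum.elim_inr]
      linarith
  let χ : V → Y₂ ⊕ Y₁ := fun v => if v ∈ B then .inr (χ₁ v) else .inl (χ₂ v)
  have hBX₁ : ∀ x ∈ X, x ∈ B → x ∈ X₁ := fun x hx hb =>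
    hB₁ x hx hb x SimpleGraph.Walk.nil (by simpa using hδ) x (by simp)
  have hBX₂ : ∀ x ∈ X, x ∉ B → x ∈ X₂ := fun x hx hb =>
    hB₂ x hx hb x SimpleGraph.Walk.nil (by simpa using hδ) x (by simp)
  have chi : ∀ v ∈ X, π (χ v) = v := by
    intro v hv
    by_cases hb : v ∈ B
    · simp [χ, hb, π, chi₁ v (hBX₁ v hv hb)]
    · simp [χ, hb, π, chi₂ v (hBX₂ v hv hb)]
  refine ⟨Y₂ ⊕ Y₁, inferInstance, T, π, .inl r₂, χ, tr, hom, ?_, chi, root₂, A, ?_, ?_, ?_⟩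
  · rintro (y | y)
    · exact hX₂ (mem₂ y)
    · exact hX₁ (mem₁ y)
  · intro v hv
    rcases hP v hv with ⟨h1, h2⟩ | ⟨h1, h2⟩
    · obtain ⟨y, hy, hy'⟩ := C₂ v h1
      refine ⟨.inl y, hy, ?_⟩
      have := d₂ r₂ y
      linarith
    · obtain ⟨y, hy, hy'⟩ := C₁ v h1
      refine ⟨.inr y, hy, ?_⟩
      have := dr y
      linarith
  · intro x hx z p
    by_cases hp : wt w p ≤ δ
    · by_cases hb : x ∈ B
      · obtain ⟨p', hp'⟩ := walk_restrict p (hB₁ x hx hb z p hp)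
        obtain ⟨y, hy, hy'⟩ := D₁ x (hBX₁ x hx hb) z p'
        refine ⟨.inr y, hy, ?_⟩
        rw [hp'] at hy'
        have := d₁ y (χ₁ x)
        simp only [χ, hb, if_true]
        linarith
      · obtain ⟨p', hp'⟩ := walk_restrict p (hB₂ x hx hb z p hp)
        obtain ⟨y, hy, hy'⟩ := D₂ x (hBX₂ x hx hb) z p'
        refine ⟨.inl y, hy, ?_⟩
        rw [hp'] at hy'
        have := d₂ y (χ₂ x)
        simp only [χ, hb, if_false]
        linarith
    · have hz : z ∈ X := support_mem p hx z (by simp)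
      refine ⟨χ z, chi z hz, ?_⟩
      have e1 := tri (χ z) (.inl r₂) (χ x)
      have e2 := A (χ z)
      have e3 := A (χ x)
      rw [spDist_comm] at e2
      rw [chi z hz] at e2
      rw [chi x hx] at e3
      have e4 := hfar x hx z hz
      have e5 : t * δ ≤ t * wt w p := mul_le_mul_of_nonneg_left (not_le.1 hp).le ht
      linarith
  · rw [Fintype.sum_sum_type]
    simp only [π, Sum.elim_inl, Sum.elim_inr]
    linarith

section recursion
variable {V : Type} [Fintype V] [DecidableEq V] {G : SimpleGraph V} {X : Finset V}

lemma Geo.padB {w w' : Sym2 V → ℝ} {o : V} {q : ℕ → V} {L : ℕ} (g : Geo G X w' o q L)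
    (le : ∀ e ∈ G.edgeSet, w' e ≤ w e) {r δ : ℝ} {x z : V} (hx : x ∈ X)
    (p : (HH G X).Walk x z) (hp : wt w p ≤ δ) {y : V} (hy : y ∈ p.support) :
    y ∈ X ∧ spDist (HH G X) w' x y ≤ δ := by
  refine ⟨support_mem p hx y hy, ?_⟩
  have h1 := wt_mono (w := w') (w' := w)
    (fun e he => le e (SimpleGraph.edgeSet_mono HH_le he)) p
  have h2 := min_walk_split (w := w') p hy
  have h3 := wt_nonneg (HH_pos g.pos X) (p.dropUntil y hy)
  have h4 := spDist_le_wt (HH_pos g.pos X) (p.takeUntil y hy)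
  linarith

lemma Geo.cut {w' : Sym2 V → ℝ} {o : V} {q : ℕ → V} {L : ℕ} (g : Geo G X w' o q L)
    {μ : V → ℝ} (hμ : ∀ v, 1 ≤ μ v) {e : ℝ} (he : 0 < e) {N : ℕ} (hN : 1 ≤ N)
    (hlog : Real.log (∑ v, μ v) ≤ (1 + e) ^ N * Real.log 2)
    {Δ : ℝ} (hΔ : 0 < Δ) (hq : Δ / 2 ≤ spDist (HH G X) w' o (q L)) :
    ∃ r σ i₁, 0 ≤ r ∧ 0 < σ ∧ r + σ ≤ Δ / 4 ∧ (512 * N : ℝ) * (σ / 8) = 8 * Δ ∧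
      (∑ v ∈ petal G X w' o q L (r + σ), μ v) ^ (1 + e) +
        (∑ v ∈ X \ petal G X w' o q L r, μ v) ^ (1 + e) ≤ (∑ v ∈ X, μ v) ^ (1 + e) ∧
      0 < i₁ ∧ i₁ ≤ L ∧
      spDist (HH G X) w' o (q L) - spDist (HH G X) w' o (q i₁) ≤ r + σ ∧
      (∀ i < i₁, r + σ < spDist (HH G X) w' o (q L) - spDist (HH G X) w' o (q i)) ∧
      o ∉ petal G X w' o q L (r + σ) ∧ q L ∈ petal G X w' o q L r := by
  have hN0 : (0 : ℝ) < N := by exact_mod_cast hN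
  set σ := Δ / (8 * N) with hσ
  have hσ0 : 0 < σ := by positivity
  have hσN : σ * N = Δ / 8 := by rw [hσ]; field_simp
  have ho : spDist (HH G X) w' o o = 0 := spDist_self (HH_pos g.pos X) o
  have hr : ∀ i : ℕ, i ≤ 2 * N → (i : ℝ) * σ ≤ Δ / 4 := by
    intro i hi
    have : (i : ℝ) ≤ 2 * N := by exact_mod_cast hi
    nlinarith
  have hnot : ∀ r, r ≤ Δ / 4 → o ∉ petal G X w' o q L r := by
    intro r hr hmem
    have := g.petal_h hmem
    linarith
  have hL : ∀ r, 0 ≤ r → q L ∈ petal G X w' o q L r := by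
    intro r hr
    rw [g.q_mem le_rfl]; linarith
  obtain ⟨j, hj, hsum⟩ := seq2 e he N hN (∑ v ∈ X, μ v)
    (fun i => ∑ v ∈ petal G X w' o q L (i * σ), μ v)
    (by
      intro i hi
      refine (hμ (q L)).trans ?_
      exact Finset.single_le_sum (f := μ) (fun v _ => by linarith [hμ v])
        (hL _ (by positivity)))
    (by
      intro i hi
      have h1 := Finset.sum_le_sum_of_subset_of_nonneg (f := μ)
        (Finset.insert_subset g.omem (g.petal_sub (r := i * σ)))
        (fun v _ _ => by linarith [hμ v])
      rw [Finset.sum_insert (hnot _ (hr i hi))] at h1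
      have := hμ o
      linarith)
    (by
      refine le_trans (Real.log_le_log ?_ ?_) hlog
      · exact Finset.sum_pos (fun v _ => by linarith [hμ v]) ⟨o, g.omem⟩
      · exact Finset.sum_le_sum_of_subset_of_nonneg (Finset.subset_univ _)
          (fun v _ _ => by linarith [hμ v]))
  have hjσ : (j : ℝ) * σ + σ = ((j + 1 : ℕ) : ℝ) * σ := by push_cast; ring
  have hle : (j : ℝ) * σ + σ ≤ Δ / 4 := by rw [hjσ]; exact hr _ (by omega)
  have hex : ∃ i, spDist (HH G X) w' o (q L) - spDist (HH G X) w' o (q i) ≤ j * σ + σ :=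
    ⟨L, by rw [sub_self]; positivity⟩
  classical
  refine ⟨j * σ, σ, Nat.find hex, by positivity, hσ0, hle, ?_, ?_, ?_, ?_, Nat.find_spec hex, ?_,
    hnot _ hle, hL _ (by positivity)⟩
  · nlinarith
  · rw [hjσ]
    have := Finset.sum_sdiff (f := μ) (g.petal_sub (r := (j : ℝ) * σ))
    have h2 : ∑ v ∈ X \ petal G X w' o q L (j * σ), μ v =
      ∑ v ∈ X, μ v - ∑ v ∈ petal G X w' o q L (j * σ), μ v := by linarith
    rw [h2]
    exact hsum
  · rw [Nat.pos_iff_ne_zero]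
    intro h0
    have := Nat.find_spec hex
    rw [h0, g.zero, ho] at this
    linarith
  · exact Nat.find_min' hex (by rw [sub_self]; positivity)
  · intro i hi
    exact not_le.1 (Nat.find_min hex hi)

/-- invariants of a cluster -/
structure IsCl (G : SimpleGraph V) (w : Sym2 V → ℝ) (X : Finset V) (w' : Sym2 V → ℝ) (p : ℕ → V)
    (l : ℕ) : Prop where
  geo : Geo G X w' (p 0) p l
  le : ∀ e ∈ G.edgeSet, w' e ≤ w e
  ge : ∀ e ∈ G.edgeSet, w e ≤ 2 * w' e
  eq : ∀ u v, G.Adj u v → u ∈ X → v ∈ X → w' s(u, v) ≠ w s(u, v) →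
    (∃ i ≤ l, p i = u) ∧ (∃ i ≤ l, p i = v)

lemma base {w : Sym2 V → ℝ} {μ : V → ℝ} (hμ : ∀ v, 1 ≤ μ v) {e t : ℝ} (he : 0 < e) (ht : 0 ≤ t)
    (hw : ∀ e ∈ G.edgeSet, 0 < w e) {o : V} {h : V → ℝ} (hh : 0 ≤ h o) (P : V → Prop)
    (hP : ∀ v, P v → v = o) : Out G w μ (1 + e) t {o} o h P := by
  have hs : spDist (⊥ : SimpleGraph Unit) (fun e => w (e.map (fun _ => o))) () () = 0 :=
    spDist_self (by simp) ()
  refine ⟨Unit, inferInstance, ⊥, fun _ => o, (), fun _ => (), SimpleGraph.IsTree.of_subsingleton,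
    by simp, by simp, by simp, rfl, ?_, ?_, ?_, ?_⟩
  · intro y; rw [hs]; linarith
  · intro v hv; rw [hP v hv]; exact ⟨(), rfl, by rw [hs]; linarith⟩
  · intro x hx z p
    refine ⟨(), ?_, ?_⟩
    · exact (Finset.mem_singleton.1 (support_mem p hx z p.end_mem_support)).symm
    · rw [hs]; exact mul_nonneg ht (wt_nonneg (HH_pos hw _) p)
  · simp only [Finset.univ_unique, Finset.sum_singleton]
    calc μ o = μ o ^ (1 : ℝ) := (Real.rpow_one _).symm
      _ ≤ _ := Real.rpow_le_rpow_of_exponent_le (hμ o) (by linarith)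

end recursion

section recursion2
variable {V : Type} [Fintype V] [DecidableEq V] {G : SimpleGraph V} {X : Finset V}

lemma Geo.glue_step {w w' : Sym2 V → ℝ} {o : V} {q : ℕ → V} {L : ℕ} (g : Geo G X w' o q L)
    (hw : ∀ e ∈ G.edgeSet, 0 < w e) (le : ∀ e ∈ G.edgeSet, w' e ≤ w e)
    {μ : V → ℝ} {ex t r σ Δ : ℝ} (hσ : 0 < σ) (ht : 0 ≤ t) (htσ : t * (σ / 8) = 8 * Δ)
    (hΔ : ∀ z ∈ X, spDist (HH G X) w' o z ≤ Δ)
    (hm : (∑ v ∈ petal G X w' o q L (r + σ), μ v) ^ ex +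
        (∑ v ∈ X \ petal G X w' o q L r, μ v) ^ ex ≤ (∑ v ∈ X, μ v) ^ ex)
    {P P₁ P₂ : V → Prop} {h₁ : V → ℝ} {o₁ y₁ : V} {s : ℝ}
    (O₁ : Out G w μ ex t (petal G X w' o q L (r + σ)) o₁ h₁ P₁)
    (O₂ : Out G w μ ex t (X \ petal G X w' o q L r) o
      (spDist (HH G (X \ petal G X w' o q L r)) w' o) P₂)
    (hy₁ : y₁ ∈ X \ petal G X w' o q L r) (hadj : G.Adj y₁ o₁)
    (hs : (P₂ y₁ ∧ 2 * spDist (HH G X) w' o y₁ ≤ s) ∨ 4 * spDist (HH G X) w' o y₁ ≤ s)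
    (hh₁ : ∀ z ∈ petal G X w' o q L (r + σ),
      s + w s(y₁, o₁) + 4 * h₁ z ≤ 4 * spDist (HH G X) w' o z)
    (hP : ∀ v, P v → (P₂ v ∧ v ∈ X \ petal G X w' o q L r) ∨
      (P₁ v ∧ s + w s(y₁, o₁) + 2 * h₁ v ≤ 2 * spDist (HH G X) w' o v)) :
    Out G w μ ex t X o (spDist (HH G X) w' o) P := by
  refine glue (B := petal G X w' o q L (r + σ / 2)) (δ := σ / 8) hw ht O₁ O₂ g.petal_sub
    Finset.sdiff_subset hy₁ hadj ?_ (fun z hz => (g.compl_dist hz).le) hh₁ ?_ ?_ ?_ (by linarith)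
    ?_ hm
  · rw [g.compl_dist hy₁]; exact hs
  · intro v hv
    rcases hP v hv with ⟨h1, h2⟩ | h
    · exact Or.inl ⟨h1, (g.compl_dist h2).le⟩
    · exact Or.inr h
  · intro x hx hxB z p hp y hy
    obtain ⟨h1, h2⟩ := g.padB (r := r) le hx p hp hy
    have := g.pad hxB h1 h2
    exact Geo.petal_mono (by linarith) this
  · intro x hx hxB z p hp y hy
    obtain ⟨h1, h2⟩ := g.padB (r := r) le hx p hp hy
    rw [Finset.mem_sdiff]
    refine ⟨h1, fun hyp => hxB ?_⟩
    rw [spDist_comm] at h2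
    have := g.pad hyp hx h2
    exact Geo.petal_mono (by linarith) this
  · intro x hx z hz
    have := hΔ x hx
    have := hΔ z hz
    linarith

lemma main_rec {w : Sym2 V → ℝ} (hw : ∀ e ∈ G.edgeSet, 0 < w e)
    {μ : V → ℝ} (hμ : ∀ v, 1 ≤ μ v) {e : ℝ} (he : 0 < e) {N : ℕ} (hN : 1 ≤ N)
    (hlog : Real.log (∑ v, μ v) ≤ (1 + e) ^ N * Real.log 2) :
    ∀ (n : ℕ) (X : Finset V) (w' : Sym2 V → ℝ) (p : ℕ → V) (l : ℕ), X.card ≤ n →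
      IsCl G w X w' p l → Out G w μ (1 + e) (512 * N) X (p 0) (spDist (HH G X) w' (p 0))
        (fun v => ∃ i ≤ l, p i = v) := by
  intro n
  induction n with
  | zero =>
    intro X w' p l hn c
    have := c.geo.omem
    rw [Nat.le_zero, Finset.card_eq_zero] at hn
    simp [hn] at this
  | succ n ih =>
  intro X w' p l hn c
  have g := c.geo
  have ht : (0 : ℝ) ≤ 512 * N := by positivity
  obtain ⟨x, hxX, hxmax⟩ := Finset.exists_max_image X (spDist (HH G X) w' (p 0)) ⟨_, g.omem⟩
  set o := p 0 with ho
  set h := spDist (HH G X) w' o with hh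
  have hΔ : 0 ≤ h x := g.nn _ _
  have hoo : h o = 0 := spDist_self (HH_pos g.pos X) o
  rcases hΔ.eq_or_lt with h0 | hpos
  · have hX : X = {o} := by
      ext z
      rw [Finset.mem_singleton]
      constructor
      · intro hz
        by_contra hne
        have := spDist_pos (HH_pos g.pos X) (g.reach z hz) (Ne.symm hne)
        have := hxmax z hz
        linarith
      · rintro rfl; exact g.omem
    clear_value h
    subst hX
    refine base hμ he ht hw hoo.ge _ ?_
    rintro v ⟨i, hi, rfl⟩
    exact Finset.mem_singleton.1 (g.mem i hi)
  have card1 : ∀ {q : ℕ → V} {L : ℕ} {r : ℝ}, o ∉ petal G X w' o q L r →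
      (petal G X w' o q L r).card ≤ n := by
    intro q L r hr
    have : petal G X w' o q L r ⊂ X := by
      rw [Finset.ssubset_iff_of_subset (show petal G X w' o q L r ⊆ X from Finset.filter_subset _ _)]
      exact ⟨o, g.omem, hr⟩
    have := Finset.card_lt_card this
    omega
  have card2 : ∀ {q : ℕ → V} {L : ℕ} {r : ℝ}, q L ∈ petal G X w' o q L r →
      (X \ petal G X w' o q L r).card ≤ n := by
    intro q L r hr
    have : X \ petal G X w' o q L r ⊂ X := by
      rw [Finset.ssubset_iff_of_subset Finset.sdiff_subset]
      exact ⟨q L, (Geo.mem_petal.1 hr).1, by simp [hr]⟩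
    have := Finset.card_lt_card this
    omega
  by_cases hcase : h x / 2 ≤ h (p l)
  · -- case A
    obtain ⟨r, σ, i₁, hr0, hσ, hrσ, htσ, hm, hi0, hiL, hle, hmin, hoX1, hLX2⟩ :=
      g.cut hμ he hN hlog hpos hcase
    obtain ⟨hM1, hM2, hM3, hM4⟩ := g.petal_main (w₁ := w') g.pos (θ := 1) one_pos hiL hle hmin
      (fun e _ => by rw [one_mul]) (fun e _ => le_rfl) (fun i _ _ => by rw [one_mul])
    set X1 := petal G X w' o p l (r + σ) with hX1
    set X2 := X \ petal G X w' o p l r with hX2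
    have c1 : IsCl G w X1 w' (fun i => p (i₁ + i)) (l - i₁) := by
      refine ⟨⟨g.pos, hM2, rfl, fun i hi => hM1 _ (by omega) (by omega), ?_⟩, c.le, c.ge, ?_⟩
      · intro i hi
        have h1 := g.step (i₁ + i) (by omega)
        refine ⟨h1.1, ?_⟩
        have h2 := hM3 (i₁ + i) (by omega) (by omega)
        have h3 := hM3 (i₁ + (i + 1)) (by omega) (by omega)
        simp only [add_zero]
        rw [h2, h3]
        have h4 := h1.2
        rw [← add_assoc, h4]
        ring
      · intro u v huv hu hv hne
        obtain ⟨⟨i, hi, rfl⟩, ⟨j, hj, rfl⟩⟩ := c.eq u v huv (g.petal_sub hu) (g.petal_sub hv) hne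
        have key : ∀ i ≤ l, p i ∈ X1 → ∃ i' ≤ l - i₁, p (i₁ + i') = p i := by
          intro i hi hm
          rw [hX1, g.q_mem hi] at hm
          have : i₁ ≤ i := by
            by_contra hlt
            have := hmin i (by omega)
            linarith
          exact ⟨i - i₁, by omega, by congr 1; omega⟩
        exact ⟨key i hi hu, key j hj hv⟩
    -- the other side
    have hex : ∃ i, h (p l) - h (p i) ≤ r := ⟨l, by rw [sub_self]; exact hr0⟩
    classical
    obtain ⟨i₂, hi₂, hi₂min⟩ : ∃ i, h (p l) - h (p i) ≤ r ∧ ∀ j < i, r < h (p l) - h (p j) :=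
      ⟨Nat.find hex, Nat.find_spec hex, fun j hj => not_le.1 (Nat.find_min hex hj)⟩
    have hi₂l : i₂ ≤ l := by
      by_contra hlt
      have := hi₂min l (by omega)
      linarith
    have hi12 : i₁ ≤ i₂ := by
      by_contra hlt
      have := hmin i₂ (by omega)
      linarith
    have mem2 : ∀ i ≤ l, (p i ∈ X2 ↔ i ≤ i₂ - 1) := by
      intro i hi
      rw [hX2, Finset.mem_sdiff, g.q_mem hi]
      constructor
      · rintro ⟨-, h2⟩
        by_contra hlt
        have := g.mono_h (i := i₂) (j := i) (by omega) hi
        exact h2 (by linarith)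
      · intro h2
        have := hi₂min i (by omega)
        exact ⟨g.mem i hi, by linarith⟩
    have c2 : IsCl G w X2 w' p (i₂ - 1) := by
      refine ⟨⟨g.pos, ?_, rfl, fun i hi => (mem2 i (by omega)).2 hi, ?_⟩, c.le, c.ge, ?_⟩
      · intro z hz
        obtain ⟨p', -⟩ := g.compl_walk (Finset.mem_sdiff.1 hz).1 (Finset.mem_sdiff.1 hz).2
        exact ⟨p'⟩
      · intro i hi
        have h1 := g.step i (by omega)
        refine ⟨h1.1, ?_⟩
        rw [g.compl_dist ((mem2 i (by omega)).2 (by omega)),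
          g.compl_dist ((mem2 (i + 1) (by omega)).2 (by omega))]
        exact h1.2
      · intro u v huv hu hv hne
        obtain ⟨⟨i, hi, rfl⟩, ⟨j, hj, rfl⟩⟩ := c.eq u v huv (Finset.sdiff_subset hu)
          (Finset.sdiff_subset hv) hne
        exact ⟨⟨i, (mem2 i hi).1 hu, rfl⟩, ⟨j, (mem2 j hj).1 hv, rfl⟩⟩
    have O1 := ih X1 w' _ _ (card1 hoX1) c1
    have O2 := ih X2 w' _ _ (card2 hLX2) c2
    simp only [add_zero] at O1
    obtain ⟨i₀, rfl⟩ : ∃ i₀, i₁ = i₀ + 1 := ⟨i₁ - 1, by omega⟩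
    have hst := g.step i₀ (by omega)
    have hge := c.ge s(p i₀, p (i₀ + 1)) hst.1
    have hst2 : h (p (i₀ + 1)) = h (p i₀) + w' s(p i₀, p (i₀ + 1)) := hst.2
    refine g.glue_step hw c.le hσ ht htσ hxmax hm O1 O2 (y₁ := p i₀) (s := 2 * h (p i₀))
      ((mem2 i₀ (by omega)).2 (by omega)) hst.1 (Or.inl ⟨⟨i₀, by omega, rfl⟩, le_rfl⟩) ?_ ?_
    · intro z hz
      obtain ⟨j, hj1, hj2, hj3, hj4⟩ := hM4 z hz
      change _ ≤ 4 * h z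
      change _ + h (p j) - h z ≤ (r + σ - (h (p l) - h (p j))) / 2 at hj3
      change _ ≤ 1 * (h (p j) - h (p (i₀ + 1))) + _ at hj4
      have := g.mono_h hj2 le_rfl
      change h (p j) ≤ h (p l) at this
      linarith
    · rintro v ⟨i, hi, rfl⟩
      by_cases hi2 : i ≤ i₂ - 1
      · exact Or.inl ⟨⟨i, hi2, rfl⟩, (mem2 i hi).2 hi2⟩
      · right
        refine ⟨⟨i - (i₀ + 1), by omega, by congr 1; omega⟩, ?_⟩
        rw [hM3 i (by omega) hi]
        change _ + 2 * (1 * (h (p i) - h (p (i₀ + 1)))) ≤ 2 * h (p i)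
        linarith
  · -- case B
    have hlt := not_le.1 hcase
    obtain ⟨q, L, hq0, hqL, hqs⟩ : ∃ (q : ℕ → V) (L : ℕ), q 0 = o ∧ q L = x ∧
      ∀ i < L, (HH G X).Adj (q i) (q (i + 1)) ∧ h (q (i + 1)) = h (q i) + w' s(q i, q (i + 1)) := by
      obtain ⟨p', hp'⟩ := exists_min_walk (HH_pos g.pos X) (g.reach x hxX)
      refine geod_seq ?_ p' (by rw [hoo, hp', zero_add])
      intro a b hab
      have h1 := g.tri g.omem hab.2.1 hab.2.2
      have h2 := spDist_adj (HH_pos g.pos X) hab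
      exact h1.trans (by linarith)
    have gq : Geo G X w' o q L := by
      refine ⟨g.pos, g.reach, hq0, ?_, fun i hi => ⟨(hqs i hi).1.1, (hqs i hi).2⟩⟩
      intro i hi
      rcases hi.eq_or_lt with rfl | hi
      · rw [hqL]; exact hxX
      · exact (hqs i hi).1.2.1
    obtain ⟨r, σ, i₁, hr0, hσ, hrσ, htσ, hm, hi0, hiL, hle, hmin, hoX1, hLX2⟩ :=
      gq.cut hμ he hN hlog hpos (by rw [hqL]; exact (half_le_self hpos.le))
    have hP : ∀ r, r ≤ h x / 4 → ∀ i ≤ l, p i ∉ petal G X w' o q L r := by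
      intro r hr i hi hmem
      have h1 := gq.petal_h hmem
      have h2 := g.mono_h hi le_rfl
      rw [hqL] at h1
      change h x - r ≤ h (p i) at h1
      change h (p i) ≤ h (p l) at h2
      linarith
    have hweq : ∀ u v, G.Adj u v → u ∈ X → v ∈ petal G X w' o q L (r + σ) →
        w' s(u, v) = w s(u, v) := by
      intro u v huv hu hv
      by_contra hne
      obtain ⟨-, ⟨j, hj, rfl⟩⟩ := c.eq u v huv hu (gq.petal_sub hv) hne
      exact hP _ hrσ j hj hv
    let w₁ : Sym2 V → ℝ := fun e =>
      open Classical in if ∀ v ∈ e, ∃ i, i₁ ≤ i ∧ i ≤ L ∧ q i = v then w e / 2 else w e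
    have hw1a : ∀ e, w₁ e = w e / 2 ∨ w₁ e = w e := by
      intro e; simp only [w₁]; split_ifs <;> simp
    have hw1 : ∀ e ∈ G.edgeSet, 0 < w₁ e ∧ w₁ e ≤ w e ∧ w e ≤ 2 * w₁ e := by
      intro e he
      have := hw e he
      rcases hw1a e with h | h <;> rw [h] <;> refine ⟨?_, ?_, ?_⟩ <;> linarith
    have hw1q : ∀ i, i₁ ≤ i → i < L → w₁ s(q i, q (i + 1)) = w s(q i, q (i + 1)) / 2 := by
      intro i h1 h2
      simp only [w₁]
      rw [if_pos]
      intro v hv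
      rcases Sym2.mem_iff.1 hv with rfl | rfl
      · exact ⟨i, h1, h2.le, rfl⟩
      · exact ⟨i + 1, by omega, h2, rfl⟩
    have hwe : ∀ e ∈ (HH G (petal G X w' o q L (r + σ))).edgeSet, w' e = w e := by
      intro e he
      induction e with
      | _ a b => exact hweq a b he.1 (gq.petal_sub he.2.1) he.2.2
    have hqmem : ∀ i, i₁ ≤ i → i ≤ L → q i ∈ petal G X w' o q L (r + σ) := by
      intro i h1 h2
      rw [gq.q_mem h2]
      have := gq.mono_h h1 h2
      linarith
    obtain ⟨hM1, hM2, hM3, hM4⟩ := gq.petal_main (w₁ := w₁) (fun e he => (hw1 e he).1)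
      (θ := 1 / 2) (by norm_num) hiL hle hmin
      (fun e he => by
        have h1 := (hw1 e (SimpleGraph.edgeSet_mono HH_le he)).2.2
        rw [hwe e he]; linarith)
      (fun e he => by
        rw [hwe e he]; exact (hw1 e (SimpleGraph.edgeSet_mono HH_le he)).2.1)
      (fun i h1 h2 => by
        rw [hw1q i h1 h2, hweq _ _ (hqs i h2).1.1 (gq.mem i h2.le) (hqmem (i + 1) (by omega) h2)]
        ring)
    set X1 := petal G X w' o q L (r + σ) with hX1
    set X2 := X \ petal G X w' o q L r with hX2
    have c1 : IsCl G w X1 w₁ (fun i => q (i₁ + i)) (L - i₁) := by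
      refine ⟨⟨fun e he => (hw1 e he).1, hM2, rfl, fun i hi => hM1 _ (by omega) (by omega), ?_⟩,
        fun e he => (hw1 e he).2.1, fun e he => (hw1 e he).2.2, ?_⟩
      · intro i hi
        have h1 := gq.step (i₁ + i) (by omega)
        refine ⟨h1.1, ?_⟩
        have h2 := hM3 (i₁ + i) (by omega) (by omega)
        have h3 := hM3 (i₁ + (i + 1)) (by omega) (by omega)
        simp only [add_zero]
        rw [h2, h3]
        have h4 := h1.2
        rw [← add_assoc, h4, hw1q _ (by omega) (by omega),
          hweq _ _ h1.1 (gq.mem _ (by omega)) (hqmem _ (by omega) (by omega))]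
        ring
      · intro u v huv hu hv hne
        have key : ∀ z ∈ s(u, v), ∃ i, i₁ ≤ i ∧ i ≤ L ∧ q i = z := by
          by_contra hcon
          exact hne (if_neg hcon)
        obtain ⟨i, hi1, hi2, hi3⟩ := key u (by simp)
        obtain ⟨j, hj1, hj2, hj3⟩ := key v (by simp)
        exact ⟨⟨i - i₁, by omega, by rw [← hi3]; show q _ = _; congr 1; omega⟩,
          ⟨j - i₁, by omega, by rw [← hj3]; show q _ = _; congr 1; omega⟩⟩
    have mem2 : ∀ i ≤ l, p i ∈ X2 := fun i hi =>
      Finset.mem_sdiff.2 ⟨g.mem i hi, hP _ (by linarith) i hi⟩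
    have c2 : IsCl G w X2 w' p l := by
      refine ⟨⟨g.pos, ?_, rfl, mem2, ?_⟩, c.le, c.ge, ?_⟩
      · intro z hz
        obtain ⟨p', -⟩ := gq.compl_walk (Finset.mem_sdiff.1 hz).1 (Finset.mem_sdiff.1 hz).2
        exact ⟨p'⟩
      · intro i hi
        have h1 := g.step i (by omega)
        refine ⟨h1.1, ?_⟩
        rw [gq.compl_dist (mem2 i (by omega)), gq.compl_dist (mem2 (i + 1) (by omega))]
        exact h1.2
      · intro u v huv hu hv hne
        exact c.eq u v huv (Finset.sdiff_subset hu) (Finset.sdiff_subset hv) hne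
    have O1 := ih X1 w₁ _ _ (card1 hoX1) c1
    have O2 := ih X2 w' _ _ (card2 hLX2) c2
    simp only [add_zero] at O1
    obtain ⟨i₀, rfl⟩ : ∃ i₀, i₁ = i₀ + 1 := ⟨i₁ - 1, by omega⟩
    have hst := gq.step i₀ (by omega)
    have hst2 : h (q (i₀ + 1)) = h (q i₀) + w' s(q i₀, q (i₀ + 1)) := hst.2
    have hwq := hweq _ _ hst.1 (gq.mem i₀ (by omega)) (hqmem (i₀ + 1) le_rfl hiL)
    have hi0' : r + σ < h (q L) - h (q i₀) := hmin i₀ (by omega)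
    refine gq.glue_step hw c.le hσ ht htσ hxmax hm O1 O2 (y₁ := q i₀) (s := 4 * h (q i₀))
      ?_ hst.1 (Or.inr le_rfl) ?_ ?_
    · rw [Finset.mem_sdiff, gq.q_mem (by omega)]
      refine ⟨gq.mem _ (by omega), ?_⟩
      change ¬ (h (q L) - h (q i₀) ≤ r)
      linarith
    · intro z hz
      obtain ⟨j, hj1, hj2, hj3, hj4⟩ := hM4 z hz
      change _ ≤ 4 * h z
      change _ + h (q j) - h z ≤ (r + σ - (h (q L) - h (q j))) / 2 at hj3
      change _ ≤ 1 / 2 * (h (q j) - h (q (i₀ + 1))) + _ at hj4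
      have := hw s(q i₀, q (i₀ + 1)) hst.1
      linarith
    · rintro v ⟨i, hi, rfl⟩
      exact Or.inl ⟨⟨i, hi, rfl⟩, mem2 i hi⟩

end recursion2

section final

lemma HH_univ {V : Type} [Fintype V] {G : SimpleGraph V} : HH G Finset.univ = G := by
  ext a b
  simp [HH]

lemma exists_tree {V : Type} [Fintype V] {G : SimpleGraph V} {w : Sym2 V → ℝ}
    (hG : G.Connected) (hw : ∀ e ∈ G.edgeSet, 0 < w e)
    {μ : V → ℝ} (hμ : ∀ v, 1 ≤ μ v) {e t : ℝ} (he : 0 < e) {N : ℕ} (hN : 1 ≤ N)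
    (ht : 512 * N ≤ t)
    (hlog : Real.log (∑ v, μ v) ≤ (1 + e) ^ N * Real.log 2) :
    ∃ (Y : Type) (_ : Fintype Y) (T : SimpleGraph Y) (wT : Sym2 Y → ℝ) (f : V → Finset Y)
      (χ : V → Y), IsSpanningClanTree G w T wT f χ t ∧
      ∑ v, μ v * ((f v).card : ℝ) ≤ (∑ v, μ v) ^ (1 + e) := by
  classical
  obtain ⟨x₀⟩ := hG.nonempty
  have c : IsCl G w Finset.univ w (fun _ => x₀) 0 := by
    refine ⟨⟨hw, fun z _ => ?_, rfl, by simp, by simp⟩, fun _ _ => le_rfl, fun e he => ?_, ?_⟩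
    · rw [HH_univ]; exact hG.preconnected _ _
    · linarith [hw e he]
    · intro u v _ _ _ h; exact absurd rfl h
  obtain ⟨Y, iY, T, π, root, χ, tr, hom, -, chi, -, -, -, D, E⟩ :=
    main_rec hw hμ he hN hlog _ _ _ _ _ le_rfl c
  have chi' : ∀ v, π (χ v) = v := fun v => chi v (Finset.mem_univ _)
  have pos := tree_pos hw hom
  refine ⟨Y, iY, T, fun e => w (e.map π), fun v => Finset.univ.filter (fun y => π y = v), χ,
    ⟨tr, pos, ?_, ?_, ?_, ?_, ?_, ?_, ?_⟩, ?_⟩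
  · intro v; exact ⟨χ v, by simp [chi']⟩
  · intro u v huv
    rw [Finset.disjoint_left]
    intro a ha hb
    simp only [Finset.mem_filter, Finset.mem_univ, true_and] at ha hb
    exact huv (ha.symm.trans hb)
  · intro y; exact ⟨π y, by simp⟩
  · intro u v u' v' hu hv hadj
    simp only [Finset.mem_filter, Finset.mem_univ, true_and] at hu hv
    subst hu hv
    exact ⟨hom _ _ hadj, by simp⟩
  · intro u v _ u' hu v' hv
    simp only [Finset.mem_filter, Finset.mem_univ, true_and] at hu hv
    subst hu hv
    let φ : T →g G := ⟨π, fun {a b} h => hom a b h⟩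
    exact spDist_hom (w := fun e => w (e.map π)) hw φ (fun e _ => rfl)
      (tr.connected.preconnected u' v')
  · intro v; simp [chi']
  · intro u v
    rw [HH_univ] at D
    obtain ⟨p, hp⟩ := exists_min_walk hw (hG.preconnected u v)
    obtain ⟨y, hy, hy'⟩ := D u (Finset.mem_univ _) v p
    refine ⟨y, by simp [hy], hy'.trans ?_⟩
    rw [hp]
    exact mul_le_mul_of_nonneg_right ht (spDist_nonneg hw u v)
  · refine le_trans (le_of_eq ?_) E
    rw [← Finset.sum_fiberwise_of_maps_to (s := Finset.univ) (t := Finset.univ) (g := π)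
      (fun _ _ => Finset.mem_univ _)]
    refine Finset.sum_congr rfl fun v _ => ?_
    rw [Finset.sum_congr rfl (g := fun _ => μ v)]
    · rw [Finset.sum_const, nsmul_eq_mul, mul_comm]
    · intro y hy
      simp only [Finset.mem_filter, Finset.mem_univ, true_and] at hy
      rw [hy]

lemma final_aux (V : Type) [Fintype V] (G : SimpleGraph V) (wG : Sym2 V → ℝ)
    (hn : 2 ≤ Fintype.card V) (hG : G.Connected) (hw : ∀ e ∈ G.edgeSet, 0 < wG e)
    (k : ℕ) (hk : 1 ≤ k) :
        ∃ (m : ℕ) (p : Fin m → ℝ)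
          (Y : Fin m → Type) (_ : ∀ i, Fintype (Y i))
          (T : ∀ i, SimpleGraph (Y i)) (wT : ∀ i, Sym2 (Y i) → ℝ)
          (f : ∀ i, V → Finset (Y i)) (χ : ∀ i, V → Y i),
          (∀ i, 0 ≤ p i) ∧ (∑ i, p i = 1) ∧
          (∀ i, IsSpanningClanTree G wG (T i) (wT i) (f i) (χ i)
              (1024 * (k : ℝ) * (1 + Real.logb 2 (Real.logb 2 (Fintype.card V))))) ∧
          ∀ v : V, ∑ i, p i * ((f i v).card : ℝ) ≤
            1024 * (Fintype.card V : ℝ) ^ (1 / (k : ℝ)) := by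
  classical
  have := hG.nonempty
  set n := Fintype.card V with hnV
  have hn0 : (0 : ℝ) < n := by
    have : 0 < n := by omega
    exact_mod_cast this
  have hk0 : (0 : ℝ) < k := by exact_mod_cast hk
  have hk1 : (1 : ℝ) ≤ k := by exact_mod_cast hk
  obtain ⟨N, hN1, hNlog, hNk⟩ := choose_N n k hn hk
  set t := 1024 * (k : ℝ) * (1 + Real.logb 2 (Real.logb 2 n)) with ht
  have htN : 512 * (N : ℝ) ≤ t := by rw [ht]; linarith
  have he : (0 : ℝ) < 1 / k := by positivity
  have hnp : (0 : ℝ) < (n : ℝ) ^ (1 / (k : ℝ)) := Real.rpow_pos_of_pos hn0 _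
  let S : Set (V → ℝ) := {s | ∃ (Y : Type) (_ : Fintype Y) (T : SimpleGraph Y)
      (wT : Sym2 Y → ℝ) (f : V → Finset Y) (χ : V → Y), IsSpanningClanTree G wG T wT f χ t ∧
      ∀ v, s v = ((f v).card : ℝ)}
  have hS : ∀ g : V → ℝ, (∀ v, 0 ≤ g v) → 0 < ∑ v, g v →
      ∃ s ∈ S, ∑ v, g v * s v ≤ (4 * (n : ℝ) ^ (1 / (k : ℝ))) * ∑ v, g v := by
    intro g hg hgs
    set A := ∑ v, g v with hA
    have hμ : ∀ v, 1 ≤ n * g v / A + 1 := fun v => by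
      have : 0 ≤ n * g v / A := by have := hg v; positivity
      linarith
    have hsum : ∑ v, (n * g v / A + 1) = 2 * n := by
      rw [Finset.sum_add_distrib, ← Finset.sum_div, ← Finset.mul_sum, ← hA]
      rw [mul_div_assoc, div_self hgs.ne']
      simp [← hnV]; ring
    obtain ⟨Y, iY, T, wT, f, χ, hT, hf⟩ := exists_tree hG hw hμ he hN1 htN
      (by rw [hsum]; exact hNlog)
    refine ⟨fun v => ((f v).card : ℝ), ⟨Y, iY, T, wT, f, χ, hT, fun v => rfl⟩, ?_⟩
    rw [hsum] at hf
    have h1 : ∑ v, (n * g v / A) * ((f v).card : ℝ) ≤ (2 * n : ℝ) ^ (1 + 1 / (k : ℝ)) := by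
      refine le_trans (Finset.sum_le_sum fun v _ => ?_) hf
      exact mul_le_mul_of_nonneg_right (by linarith) (Nat.cast_nonneg _)
    have h2 : ∑ v, (n * g v / A) * ((f v).card : ℝ) = n / A * ∑ v, g v * ((f v).card : ℝ) := by
      rw [Finset.mul_sum]
      refine Finset.sum_congr rfl fun v _ => by ring
    have h3 : (2 * n : ℝ) ^ (1 + 1 / (k : ℝ)) ≤ n * (4 * (n : ℝ) ^ (1 / (k : ℝ))) := by
      rw [Real.rpow_add (by positivity), Real.rpow_one, Real.mul_rpow (by norm_num) hn0.le]
      have h4 : (2 : ℝ) ^ (1 / (k : ℝ)) ≤ 2 := by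
        calc (2 : ℝ) ^ (1 / (k : ℝ)) ≤ 2 ^ (1 : ℝ) :=
              Real.rpow_le_rpow_of_exponent_le (by norm_num) (by rw [div_le_one hk0]; exact hk1)
          _ = 2 := Real.rpow_one _
      have := mul_le_mul_of_nonneg_right h4 (mul_pos hn0 hnp).le
      nlinarith
    rw [h2] at h1
    have h5 := h1.trans h3
    have h6 := mul_le_mul_of_nonneg_right h5 (by positivity : 0 ≤ A / n)
    have h7 : n / A * (∑ v, g v * ((f v).card : ℝ)) * (A / n) = ∑ v, g v * ((f v).card : ℝ) := by
      field_simp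
    have h8 : n * (4 * (n : ℝ) ^ (1 / (k : ℝ))) * (A / n) = 4 * (n : ℝ) ^ (1 / (k : ℝ)) * A := by
      field_simp
    rw [h7, h8] at h6
    exact h6
  obtain ⟨x, hx, hxc⟩ := minimax S (4 * (n : ℝ) ^ (1 / (k : ℝ))) (5 * (n : ℝ) ^ (1 / (k : ℝ)))
    (by linarith) hS
  rw [mem_convexHull_iff_exists_fintype] at hx
  obtain ⟨ι, _, p, z, hp0, hp1, hz, rfl⟩ := hx
  choose Y iY T wT f χ hT hf using hz
  let E := (Fintype.equivFin ι).symm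
  refine ⟨Fintype.card ι, fun i => p (E i), fun i => Y (E i), fun i => iY (E i), fun i => T (E i),
    fun i => wT (E i), fun i => f (E i), fun i => χ (E i), fun i => hp0 _, ?_, fun i => hT _, ?_⟩
  · rw [Equiv.sum_comp E p]; exact hp1
  · intro v
    have h1 := hxc v
    rw [Finset.sum_apply] at h1
    rw [Equiv.sum_comp E (fun i => p i * ((f i v).card : ℝ))]
    have h2 : ∑ i, p i * ((f i v).card : ℝ) = ∑ i, (p i • z i) v :=
      Finset.sum_congr rfl fun i _ => by simp [hf i v]
    rw [h2]
    linarith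

end final

end SCE

/-- a finitely supported distribution over spanning clan embeddings into
trees, each with multiplicative distortion `≤ C·k·(1 + log₂ log₂ n)`, with expected clan
size of every vertex at most `C·n^{1/k}`. -/
theorem spanning_clan_embedding_distribution_k :
    ∃ C : ℝ, 0 < C ∧
      ∀ (V : Type) [Fintype V], ∀ (G : SimpleGraph V) (wG : Sym2 V → ℝ),
        2 ≤ Fintype.card V → G.Connected → (∀ e ∈ G.edgeSet, 0 < wG e) →
        ∀ k : ℕ, 1 ≤ k →
        ∃ (m : ℕ) (p : Fin m → ℝ)
          (Y : Fin m → Type) (_ : ∀ i, Fintype (Y i))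
          (T : ∀ i, SimpleGraph (Y i)) (wT : ∀ i, Sym2 (Y i) → ℝ)
          (f : ∀ i, V → Finset (Y i)) (χ : ∀ i, V → Y i),
          (∀ i, 0 ≤ p i) ∧ (∑ i, p i = 1) ∧
          (∀ i, IsSpanningClanTree G wG (T i) (wT i) (f i) (χ i)
              (C * (k : ℝ) * (1 + Real.logb 2 (Real.logb 2 (Fintype.card V))))) ∧
          ∀ v : V, ∑ i, p i * ((f i v).card : ℝ) ≤
            C * (Fintype.card V : ℝ) ^ (1 / (k : ℝ)) := by
  exact ⟨1024, by norm_num, fun V _ G wG hn hG hw k hk => SCE.final_aux V G wG hn hG hw k hk⟩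
end
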